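/- arXiv:1302.1392 — 5 statements merged into one kernel-verified Lean document; each statement's English description precedes it below -/
import Mathlib

section
/- Let (X, μ) be a probability space and let a group G act on X by measure-preserving transformations. Then the induced isometric linear representation ρ: G → GL(L¹(X, μ)), (ρ(g)f)(x) = f(g⁻¹x), is weakly almost periodic: every orbit ρ(G)f is relatively weakly compact in L¹(X, μ). -/
open MeasureTheory

open Filter Topology in
lemma wap_hilbert_limit {G H : Type*} [NormedAddCommGroup H] [InnerProductSpace ℝ H]
    [CompleteSpace H] (u : G → H) (r : ℝ) (hu : ∀ g, ‖u g‖ ≤ r) (U : Ultrafilter G) :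
    ∃ h : H, ∀ l : H →L[ℝ] ℝ, Tendsto (fun g => l (u g)) U (𝓝 (l h)) := by
  let φ : G → WeakDual ℝ H := fun g => StrongDual.toWeakDual (InnerProductSpace.toDual ℝ H (u g))
  have hc := WeakDual.isCompact_closedBall (𝕜 := ℝ) (E := H) 0 r
  have hle : ((U.map φ : Ultrafilter (WeakDual ℝ H)) : Filter (WeakDual ℝ H)) ≤
      𝓟 (WeakDual.toStrongDual ⁻¹' Metric.closedBall (0 : StrongDual ℝ H) r) := by
    rw [le_principal_iff]
    refine Filter.mem_map.2 (Filter.mem_of_superset Filter.univ_mem fun g _ => ?_)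
    exact (mem_closedBall_zero_iff.2 (by simpa [φ] using hu g) :
        WeakDual.toStrongDual (φ g) ∈ Metric.closedBall (0 : StrongDual ℝ H) r)
  obtain ⟨ψ, -, hψ⟩ := hc.ultrafilter_le_nhds _ hle
  have hψ' : Tendsto φ U (𝓝 ψ) := hψ
  refine ⟨(InnerProductSpace.toDual ℝ H).symm (WeakDual.toStrongDual ψ), fun l => ?_⟩
  obtain ⟨w, rfl⟩ := (InnerProductSpace.toDual ℝ H).surjective l
  have h1 := ((WeakDual.eval_continuous (𝕜 := ℝ) w).tendsto ψ).comp hψ'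
  have e1 : ∀ g, (InnerProductSpace.toDual ℝ H w) (u g) = φ g w := by
    intro g
    simp [φ, real_inner_comm]
  have e2 : (InnerProductSpace.toDual ℝ H w)
      ((InnerProductSpace.toDual ℝ H).symm (WeakDual.toStrongDual ψ)) = ψ w := by
    rw [InnerProductSpace.toDual_apply_apply, real_inner_comm,
      InnerProductSpace.toDual_symm_apply]
    rfl
  rw [e2]
  simpa [e1, Function.comp_def] using h1

open Filter Topology in
lemma wap_limit {G H E : Type*} [NormedAddCommGroup H] [InnerProductSpace ℝ H]
    [CompleteSpace H] [NormedAddCommGroup E] [NormedSpace ℝ E] [CompleteSpace E]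
    (J : H →L[ℝ] E) (hJ : DenseRange J) (T : G → E →L[ℝ] E) (hT : ∀ g f, ‖T g f‖ ≤ ‖f‖)
    (S : G → H → H) (hS : ∀ g u, ‖S g u‖ ≤ ‖u‖) (hTS : ∀ g u, T g (J u) = J (S g u))
    (U : Ultrafilter G) (f : E) :
    ∃ h : E, ∀ l : E →L[ℝ] ℝ, Tendsto (fun g => l (T g f)) U (𝓝 (l h)) := by
  have key : ∀ u : H, ∃ h : E, ∀ l : E →L[ℝ] ℝ,
      Tendsto (fun g => l (T g (J u))) U (𝓝 (l h)) := by
    intro u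
    obtain ⟨h, hh⟩ := wap_hilbert_limit (fun g => S g u) ‖u‖ (fun g => hS g u) U
    exact ⟨J h, fun l => by simpa [hTS] using hh (l.comp J)⟩
  obtain ⟨x, hx, hxf⟩ := mem_closure_iff_seq_limit.1 (hJ f)
  choose u hu using hx
  choose h hh using fun n => key (u n)
  simp only [hu] at hh
  have hd : ∀ n m, dist (h n) (h m) ≤ dist (x n) (x m) := by
    intro n m
    rw [dist_eq_norm, dist_eq_norm]
    refine NormedSpace.norm_le_dual_bound ℝ _ (norm_nonneg _) fun l => ?_
    have h1 := ((hh n l).sub (hh m l)).norm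
    rw [map_sub]
    refine le_of_tendsto h1 (Eventually.of_forall fun g => ?_)
    rw [← map_sub, ← map_sub, mul_comm]
    exact (l.le_opNorm _).trans (mul_le_mul_of_nonneg_left (hT g _) (norm_nonneg _))
  have hC : CauchySeq h := by
    have := hxf.cauchySeq
    rw [Metric.cauchySeq_iff] at this ⊢
    intro ε hε
    obtain ⟨N, hN⟩ := this ε hε
    exact ⟨N, fun m hm n hn => (hd m n).trans_lt (hN m hm n hn)⟩
  obtain ⟨h0, hh0⟩ := cauchySeq_tendsto_of_complete hC
  refine ⟨h0, fun l => ?_⟩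
  have hU : TendstoUniformly (fun n g => l (T g (x n))) (fun g => l (T g f)) atTop := by
    rw [Metric.tendstoUniformly_iff]
    intro ε hε
    have h1 : Tendsto (fun n => ‖l‖ * ‖f - x n‖) atTop (𝓝 0) := by
      have := ((tendsto_const_nhds (x := f)).sub hxf).norm.const_mul ‖l‖
      simpa using this
    filter_upwards [h1.eventually (gt_mem_nhds hε)] with n hn g
    refine lt_of_le_of_lt ?_ hn
    rw [dist_eq_norm, ← map_sub, ← map_sub]
    exact (l.le_opNorm _).trans (mul_le_mul_of_nonneg_left (hT g _) (norm_nonneg _))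
  exact (hU.tendstoUniformlyOnFilter.mono_right le_top).tendsto_of_eventually_tendsto
    (Eventually.of_forall fun n => hh n l) ((l.continuous.tendsto h0).comp hh0)

open Filter Topology in
lemma wap_compact {G E : Type*} [NormedAddCommGroup E] [NormedSpace ℝ E] (φ : G → E)
    (h : ∀ U : Ultrafilter G, ∃ h : E, ∀ l : E →L[ℝ] ℝ,
      Tendsto (fun g => l (φ g)) U (𝓝 (l h))) :
    IsCompact (closure ((toWeakSpace ℝ E) '' (Set.range φ))) := by
  letI : TopologicalSpace G := ⊥
  haveI : DiscreteTopology G := ⟨rfl⟩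
  let F : G → WeakSpace ℝ E := fun g => toWeakSpace ℝ E (φ g)
  have hF : ∀ U : Ultrafilter G, ∃ c, Tendsto F (comap pure (𝓝 U)) (𝓝 c) := by
    intro U
    obtain ⟨c, hc⟩ := h U
    refine ⟨toWeakSpace ℝ E c, Tendsto.mono_left ?_ (ultrafilter_comap_pure_nhds U)⟩
    refine ((NormedSpace.isEmbedding_inclusionInDoubleDualWeak ℝ E).tendsto_nhds_iff).2 ?_
    exact tendsto_iff_forall_eval_tendsto_topDualPairing.2 hc
  have hcont := isDenseInducing_pure.continuous_extend hF
  refine (isCompact_range hcont).closure_of_subset ?_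
  rintro _ ⟨_, ⟨g, rfl⟩, rfl⟩
  exact ⟨pure g, isDenseInducing_pure.extend_eq continuous_of_discreteTopology g⟩

/-- The inclusion of L² in L¹. -/
noncomputable def wapJ {X : Type*} [MeasurableSpace X] (μ : Measure X) [IsProbabilityMeasure μ] :
    Lp ℝ 2 μ →L[ℝ] Lp ℝ 1 μ :=
  LinearMap.mkContinuous
    { toFun := fun u => ⟨u.1, Lp.antitone (by norm_num) u.2⟩
      map_add' := fun _ _ => rfl
      map_smul' := fun _ _ => rfl } 1 (by
    intro u
    rw [one_mul, Lp.norm_def, Lp.norm_def]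
    exact ENNReal.toReal_mono (Lp.eLpNorm_ne_top u)
      (eLpNorm_le_eLpNorm_of_exponent_le (by norm_num) (Lp.aestronglyMeasurable u)))

lemma wapJ_coe {X : Type*} [MeasurableSpace X] (μ : Measure X) [IsProbabilityMeasure μ]
    (u : Lp ℝ 2 μ) : (wapJ μ u : X → ℝ) = u := rfl

lemma wapJ_dense {X : Type*} [MeasurableSpace X] (μ : Measure X) [IsProbabilityMeasure μ] :
    DenseRange (wapJ μ) := by
  intro f
  rw [Metric.mem_closure_iff]
  intro ε hε
  obtain ⟨s, hs, hs1⟩ := (Lp.memLp f).exists_simpleFunc_eLpNorm_sub_lt (by norm_num)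
    (ε := ENNReal.ofReal ε) (by simpa using hε)
  have hs2 : MemLp s 2 μ := s.memLp_of_isFiniteMeasure 2 μ
  refine ⟨_, ⟨hs2.toLp s, rfl⟩, ?_⟩
  rw [dist_eq_norm, Lp.norm_def]
  refine ENNReal.toReal_lt_of_lt_ofReal (lt_of_eq_of_lt (eLpNorm_congr_ae ?_) hs)
  filter_upwards [Lp.coeFn_sub f (wapJ μ (hs2.toLp s)), hs2.coeFn_toLp] with x h1 h2
  rw [h1, Pi.sub_apply, Pi.sub_apply, wapJ_coe, h2]

theorem measure_preserving_rep_on_L1_is_wap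
    {X : Type*} [MeasurableSpace X] (μ : Measure X) [IsProbabilityMeasure μ]
    {G : Type*} [Group G]
    -- a measure-preserving action of `G` on `X`:
    (τ : G → X → X)
    (hact_one : τ 1 = id)
    (hact_mul : ∀ g h : G, τ (g * h) = τ g ∘ τ h)
    (hmp : ∀ g : G, MeasurePreserving (τ g) μ μ)
    -- the induced representation on `L¹(X, μ)`, i.e. `(ρ(g)f)(x) = f(g⁻¹ x)`:
    (ρ : G →* (Lp ℝ 1 μ ≃L[ℝ] Lp ℝ 1 μ))
    (hρ : ∀ (g : G) (f : Lp ℝ 1 μ), (ρ g f : Lp ℝ 1 μ) =ᵐ[μ] fun x => f (τ g⁻¹ x)) :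
    ∀ f : Lp ℝ 1 μ,
      IsCompact (closure ((toWeakSpace ℝ (Lp ℝ 1 μ)) '' (Set.range fun g => ρ g f))) := by
  intro f
  refine wap_compact _ fun U => ?_
  refine wap_limit (wapJ μ) (wapJ_dense μ) (fun g => (ρ g : Lp ℝ 1 μ →L[ℝ] Lp ℝ 1 μ)) ?_
    (fun g u => Lp.compMeasurePreserving (τ g⁻¹) (hmp g⁻¹) u)
    (fun g u => (Lp.norm_compMeasurePreserving u (hmp g⁻¹)).le) ?_ U f
  · intro g f
    have : ρ g f = Lp.compMeasurePreserving (τ g⁻¹) (hmp g⁻¹) f :=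
      Lp.ext ((hρ g f).trans (Lp.coeFn_compMeasurePreserving f (hmp g⁻¹)).symm)
    change ‖ρ g f‖ ≤ _
    rw [this, Lp.norm_compMeasurePreserving]
  · intro g u
    refine Lp.ext ((hρ g (wapJ μ u)).trans ?_)
    rw [wapJ_coe, wapJ_coe]
    exact (Lp.coeFn_compMeasurePreserving u (hmp g⁻¹)).symm
end

section
/- (Jacobs–de Leeuw–Glicksberg decomposition) Let V be a Banach space and ρ: G → GL(V) a weakly almost periodic representation of a group G. Then V decomposes as a topological direct sum V = V₁ ⊕ V₂ of closed G-invariant linear subspaces, where V₁ = {v ∈ V : ρ(G)v is relatively norm compact} is exactly the set of almost periodic vectors and V₂ = {v ∈ V : 0 lies in the weak closure of ρ(G)v} is exactly the set of furtive vectors. -/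
section
open Set Filter Topology

theorem jdlg_fragment {Q K : Type*} [TopologicalSpace Q] [TopologicalSpace K] [CompactSpace Q]
    [Nonempty Q] [CompactSpace K] (F : Q → K → ℝ) (h1 : ∀ q, Continuous (F q))
    (h2 : ∀ k, Continuous (fun q => F q k)) (ε : ℝ) (hε : 0 < ε) :
    ∃ U : Set Q, IsOpen U ∧ U.Nonempty ∧ ∀ q ∈ U, ∀ q' ∈ U, ∀ k, |F q k - F q' k| ≤ ε := by
  by_contra! hcon
  have step : ∀ U : {U : Set Q // IsOpen U ∧ U.Nonempty},
      ∃ (C : Bool → {U : Set Q // IsOpen U ∧ U.Nonempty}) (k : K),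
        (∀ b, (C b).1 ⊆ U.1) ∧ ∀ q ∈ (C true).1, ∀ q' ∈ (C false).1,
          ε / 3 ≤ |F q k - F q' k| := by
    rintro ⟨U, hU, hne⟩
    obtain ⟨q, hq, q', hq', k, hk⟩ := hcon U hU hne
    have key : ∀ a : Q, a ∈ U → IsOpen (U ∩ {x | |F x k - F a k| < ε / 3}) ∧
        (U ∩ {x | |F x k - F a k| < ε / 3}).Nonempty := by
      intro a ha
      refine ⟨hU.inter (isOpen_lt ((h2 k).sub continuous_const).abs continuous_const), a, ha, ?_⟩
      simp only [mem_ofPred_eq, sub_self, abs_zero]; positivity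
    refine ⟨fun b => if b then ⟨_, key q hq⟩ else ⟨_, key q' hq'⟩, k, ?_, ?_⟩
    · intro b; cases b <;> simp
    · rintro x hx y hy
      simp only [if_true] at hx
      simp at hy
      have e1 := hx.2
      have e2 := hy.2
      simp only [mem_ofPred_eq] at e1
      rw [abs_lt] at e1 e2
      by_contra! h3
      rw [abs_lt] at h3
      have : |F q k - F q' k| ≤ ε := by rw [abs_le]; constructor <;> linarith
      linarith
  choose C kk hsub hsep using step
  let T : List Bool → {U : Set Q // IsOpen U ∧ U.Nonempty} :=
    fun s => List.rec ⟨univ, isOpen_univ, univ_nonempty⟩ (fun b _ t => C t b) s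
  have hT : ∀ b s, T (b :: s) = C (T s) b := fun b s => rfl
  choose x hx using fun s => (T s).2.2
  let path : (ℕ → Bool) → ℕ → List Bool := fun σ n => Nat.rec [] (fun m l => σ m :: l) n
  have hp : ∀ σ n, path σ (n+1) = σ n :: path σ n := fun σ n => rfl
  have hanti : ∀ σ, Antitone (fun n => (T (path σ n)).1) := by
    intro σ
    refine antitone_nat_of_succ_le fun n => ?_
    rw [hp, hT]; exact hsub _ _
  have hz : ∀ σ : ℕ → Bool, ∃ z : Q, MapClusterPt z atTop (fun n => x (path σ n)) := by
    intro σ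
    obtain ⟨z, hz⟩ := exists_clusterPt_of_compactSpace (Filter.map (fun n => x (path σ n)) atTop)
    exact ⟨z, hz⟩
  choose z hz using hz
  have hzc : ∀ σ n, z σ ∈ closure (T (path σ n)).1 := by
    intro σ n
    refine mem_closure_iff_clusterPt.2 (ClusterPt.mono (hz σ) ?_)
    rw [le_principal_iff, mem_map]
    filter_upwards [eventually_ge_atTop n] with m hm
    exact hanti σ hm (hx _)
  have hzr : ∀ σ, z σ ∈ closure (range x) := by
    intro σ
    refine mem_closure_iff_clusterPt.2 (ClusterPt.mono (hz σ) ?_)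
    rw [le_principal_iff, mem_map]
    exact Eventually.of_forall fun m => mem_range_self _
  have hsepT : ∀ s k, k = kk (T s) → ∀ a ∈ closure (T (true :: s)).1,
      ∀ b ∈ closure (T (false :: s)).1, ε / 3 ≤ |F a k - F b k| := by
    intro s k hk a ha b hb
    have hcl : IsClosed {p : Q × Q | ε / 3 ≤ |F p.1 k - F p.2 k|} :=
      isClosed_le continuous_const
        ((((h2 k).comp continuous_fst).sub ((h2 k).comp continuous_snd)).abs)
    have : (a, b) ∈ closure ((T (true :: s)).1 ×ˢ (T (false :: s)).1) := by
      rw [closure_prod_eq]; exact ⟨ha, hb⟩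
    refine closure_minimal ?_ hcl this
    rintro ⟨p, p'⟩ ⟨hp1, hp2⟩
    subst hk
    exact hsep (T s) p hp1 p' hp2
  have hdist : ∀ σ τ : ℕ → Bool, σ ≠ τ → ∃ k, ε / 3 ≤ |F (z σ) k - F (z τ) k| := by
    intro σ τ hne
    have hex : ∃ n, σ n ≠ τ n := by
      by_contra! h; exact hne (funext h)
    classical
    let n := Nat.find hex
    have hn : σ n ≠ τ n := Nat.find_spec hex
    have hlt : ∀ m < n, σ m = τ m := fun m hm => by
      by_contra h; exact Nat.find_min hex hm h
    have hpe : ∀ m ≤ n, path σ m = path τ m := by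
      intro m
      induction m with
      | zero => intro _; rfl
      | succ m ih => intro hm; rw [hp, hp, ih (by omega), hlt m (by omega)]
    have hs := hpe n le_rfl
    have c1 := hzc σ (n+1)
    have c2 := hzc τ (n+1)
    rw [hp] at c1 c2
    rw [← hs] at c2
    refine ⟨kk (T (path σ n)), ?_⟩
    cases h3 : σ n <;> cases h4 : τ n <;> rw [h3] at c1 <;> rw [h4] at c2
    · exact absurd (h3.trans h4.symm) hn
    · rw [abs_sub_comm]; exact hsepT _ _ rfl _ c2 _ c1
    · exact hsepT _ _ rfl _ c1 _ c2
    · exact absurd (h3.trans h4.symm) hn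
  -- the metrizable quotient
  let Φ : K → (List Bool → ℝ) := fun k s => F (x s) k
  have hΦ : Continuous Φ := continuous_pi fun s => h1 _
  let R := range Φ
  have : CompactSpace R := isCompact_iff_compactSpace.1 (isCompact_range hΦ)
  let f : C(K, R) := ⟨fun k => ⟨Φ k, mem_range_self k⟩, hΦ.subtype_mk _⟩
  have hfs : Function.Surjective f := by
    rintro ⟨_, k, rfl⟩; exact ⟨k, rfl⟩
  have hq : IsQuotientMap f := f.continuous.isClosedMap.isQuotientMap f.continuous hfs
  have hfac : ∀ σ, Function.FactorsThrough (⟨F (z σ), h1 _⟩ : C(K, ℝ)) f := by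
    intro σ k k' hkk
    have hkk' : Φ k = Φ k' := congrArg Subtype.val hkk
    have hcl : IsClosed {q : Q | F q k = F q k'} := isClosed_eq (h2 k) (h2 k')
    refine closure_minimal ?_ hcl (hzr σ)
    rintro _ ⟨s, rfl⟩
    exact congrFun hkk' s
  let h : (ℕ → Bool) → C(R, ℝ) := fun σ => hq.lift _ (hfac σ)
  have hh : ∀ σ k, h σ (f k) = F (z σ) k := fun σ k => by
    have := hq.lift_comp _ (hfac σ)
    exact congrArg (fun g : C(K, ℝ) => g k) this
  have hd : ∀ σ τ, σ ≠ τ → ε / 3 ≤ dist (h σ) (h τ) := by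
    intro σ τ hne
    obtain ⟨k, hk⟩ := hdist σ τ hne
    rw [← hh, ← hh, ← Real.dist_eq] at hk
    exact hk.trans (ContinuousMap.dist_apply_le_dist _)
  have : Nonempty C(R, ℝ) := ⟨0⟩
  have hdense := TopologicalSpace.denseRange_denseSeq C(R, ℝ)
  choose N hN using fun σ => hdense.exists_dist_lt (h σ) (show 0 < ε / 6 by positivity)
  have hinj : Function.Injective N := by
    intro σ τ hst
    by_contra hne
    have a1 := hN σ
    have a2 := hN τ
    rw [hst] at a1
    have := dist_triangle_right (h σ) (h τ) (TopologicalSpace.denseSeq C(R, ℝ) (N τ))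
    linarith [hd σ τ hne]
  exact Function.cantor_injective (fun s : Set ℕ => by
    classical exact N (fun n => decide (n ∈ s))) (by
      intro s t hst
      have := hinj hst
      ext n
      simpa using congrFun this n)

theorem jdlg_equi {G Q K : Type*} [TopologicalSpace Q] [TopologicalSpace K] [CompactSpace Q]
    [CompactSpace K] (F : Q → K → ℝ) (h1 : ∀ q, Continuous (F q))
    (h2 : ∀ k, Continuous (fun q => F q k)) (a : G → Q → Q) (ha : ∀ g, Continuous (a g))
    (c : ℝ) (hc : 0 < c)
    (hinv : ∀ g k, ∃ k', ∀ q, F q k = c * F (a g q) k')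
    (hmin : ∀ q, DenseRange (fun g => a g q)) (ε : ℝ) (hε : 0 < ε) (q : Q) :
    ∃ U : Set Q, IsOpen U ∧ q ∈ U ∧ ∀ q ∈ U, ∀ q' ∈ U, ∀ k, |F q k - F q' k| ≤ ε := by
  have : Nonempty Q := ⟨q⟩
  obtain ⟨U, hU, hne, hUε⟩ := jdlg_fragment F h1 h2 (ε / c) (by positivity)
  obtain ⟨g, hg⟩ := (hmin q).exists_mem_open hU hne
  refine ⟨a g ⁻¹' U, hU.preimage (ha g), hg, fun p hp p' hp' k => ?_⟩
  obtain ⟨k', hk'⟩ := hinv g k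
  rw [hk', hk', ← mul_sub, abs_mul, abs_of_pos hc]
  have := hUε _ hp _ hp' k'
  rw [le_div_iff₀ hc] at this
  linarith

theorem jdlg_cancel {G S : Type*} [Group G] [Monoid S] [TopologicalSpace S] [CompactSpace S]
    [T2Space S] (hl : ∀ s : S, Continuous (fun x => s * x)) (hr : ∀ s : S, Continuous (fun x => x * s))
    (i : G →* S) (hd : DenseRange i) (e : S) (he : ∀ s, ∃ t, t * s * e = e) (x y s : S)
    (hs : s * (x * e) = s * (y * e)) : x * e = y * e := by
  by_contra hne
  obtain ⟨φ, hφ⟩ : ∃ φ : C(S, ℝ), φ (x * e) ≠ φ (y * e) := by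
    obtain ⟨φ, h0, h1, -⟩ := exists_continuous_zero_one_of_isClosed
      (isClosed_singleton (x := x * e)) (isClosed_singleton (x := y * e)) (by simpa using hne)
    refine ⟨φ, ?_⟩
    rw [h0 rfl, h1 rfl]; simp
  let Q := range (fun x => x * e)
  have : CompactSpace Q := isCompact_iff_compactSpace.1 (isCompact_range (hr e))
  let a : G → Q → Q := fun g q => ⟨i g * q.1, by
    obtain ⟨_, w, rfl⟩ := q; exact ⟨i g * w, mul_assoc _ _ _⟩⟩
  have hmin : ∀ q, DenseRange (fun g => a g q) := by
    rintro ⟨_, w, rfl⟩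
    rw [DenseRange, dense_iff_inter_open]
    rintro _ ⟨U, hU, rfl⟩ ⟨⟨_, v, rfl⟩, hv⟩
    obtain ⟨t, ht⟩ := he w
    have : v * t ∈ (fun s => s * (w * e)) ⁻¹' U := by
      show v * t * (w * e) ∈ U
      rw [mul_assoc, ← mul_assoc t, ht]; exact hv
    obtain ⟨g, hg⟩ := hd.exists_mem_open (hU.preimage (hr (w * e))) ⟨_, this⟩
    exact ⟨_, hg, g, rfl⟩
  have hpos : 0 < |φ (x * e) - φ (y * e)| := abs_pos.2 (sub_ne_zero.2 hφ)
  have hinv : ∀ g (k : S), ∃ k' : S, ∀ q : Q, φ (k * q.1) = 1 * φ (k' * (a g q).1) := by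
    intro g k
    refine ⟨k * i g⁻¹, fun q => ?_⟩
    have : k * i g⁻¹ * (i g * q.1) = k * q.1 := by
      rw [mul_assoc, ← mul_assoc (i g⁻¹), ← map_mul]; simp
    show _ = 1 * φ (k * i g⁻¹ * (i g * q.1))
    rw [this, one_mul]
  obtain ⟨_, ⟨U, hU, rfl⟩, hpU, hUε⟩ := jdlg_equi (fun (q : Q) (k : S) => φ (k * q.1))
    (fun q => φ.continuous.comp (hr _)) (fun k => φ.continuous.comp ((hl k).comp continuous_subtype_val))
    a (fun g => ((hl _).comp continuous_subtype_val).subtype_mk _) 1 one_pos hinv hmin _ (half_pos hpos)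
    ⟨s * (x * e), s * x, mul_assoc _ _ _⟩
  have m1 : s * (x * e) ∈ U := hpU
  have m2 : s * (y * e) ∈ U := hs ▸ m1
  obtain ⟨g, hg1, hg2⟩ := hd.exists_mem_open
    ((hU.preimage (hr (x * e))).inter (hU.preimage (hr (y * e)))) ⟨s, m1, m2⟩
  have := hUε (a g ⟨x * e, x, rfl⟩) hg1 (a g ⟨y * e, y, rfl⟩) hg2 (i g⁻¹)
  have cc : ∀ w : S, i g⁻¹ * (i g * w) = w := by
    intro w; rw [← mul_assoc, ← map_mul]; simp
  simp only [a, cc] at this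
  linarith

theorem jdlg_exists_min {S : Type*} [Monoid S] [TopologicalSpace S] [CompactSpace S]
    [T2Space S] (hl : ∀ s : S, Continuous (fun x => s * x)) (hr : ∀ s : S, Continuous (fun x => x * s)) :
    ∃ e : S, e * e = e ∧ ∀ s, ∃ t, t * s * e = e := by
  let P : Set (Set S) := {L | IsClosed L ∧ L.Nonempty ∧ ∀ s, ∀ x ∈ L, s * x ∈ L}
  obtain ⟨L, -, hL⟩ := zorn_superset_nonempty P (by
    rintro c hc hch ⟨L₀, hL₀⟩
    refine ⟨⋂₀ c, ⟨isClosed_sInter fun L h => (hc h).1, ?_, ?_⟩, fun s hs => sInter_subset_of_mem hs⟩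
    · have : Nonempty c := ⟨⟨L₀, hL₀⟩⟩
      exact IsCompact.nonempty_sInter_of_directed_nonempty_isCompact_isClosed
        (IsChain.directedOn (r := fun a b : Set S => a ⊇ b) hch.symm) (fun L h => (hc h).2.1)
        (fun L h => (hc h).1.isCompact) (fun L h => (hc h).1)
    · intro s x hx L h
      exact (hc h).2.2 s x (hx L h)) univ ⟨isClosed_univ, univ_nonempty, fun _ _ _ => mem_univ _⟩
  obtain ⟨⟨hcl, hne, hid⟩, hmin⟩ := hL
  obtain ⟨e, heL, hee⟩ := exists_idempotent_in_compact_subsemigroup hr L hne hcl.isCompact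
    (fun x _ y hy => hid x y hy)
  refine ⟨e, hee, fun s => ?_⟩
  have h := hmin (y := range (fun t => t * (s * e))) ⟨(isCompact_range (hr _)).isClosed,
    range_nonempty _, ?_⟩ ?_
  · obtain ⟨t, ht⟩ := h heL
    exact ⟨t, by simpa [mul_assoc] using ht⟩
  · rintro w _ ⟨t, rfl⟩
    exact ⟨w * t, mul_assoc _ _ _⟩
  · rintro _ ⟨t, rfl⟩
    exact hid _ _ (hid _ _ heL)

theorem jdlg_semigroup {G S : Type*} [Group G] [Monoid S] [TopologicalSpace S] [CompactSpace S]
    [T2Space S] (hl : ∀ s : S, Continuous (fun x => s * x)) (hr : ∀ s : S, Continuous (fun x => x * s))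
    (i : G →* S) (hd : DenseRange i) :
    ∃ e : S, e * e = e ∧ (∀ s, ∃ t, t * s * e = e) ∧ ∀ s, s * e = e * s := by
  obtain ⟨e, hee, he⟩ := jdlg_exists_min hl hr
  refine ⟨e, hee, he, ?_⟩
  have h1 : ∀ s, e * s * e = s * e := fun s =>
    jdlg_cancel hl hr i hd e he (e * s) s e (by simp only [← mul_assoc, hee])
  have he' : ∀ s, ∃ t, e * (s * t) = e := by
    intro s
    obtain ⟨t, ht⟩ := he s
    obtain ⟨u, hu⟩ := he t
    -- `y = t e`, `x = s e`
    have hyx : (t * e) * (s * e) = e := by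
      rw [mul_assoc, ← mul_assoc e, h1, ← mul_assoc, ht]
    have hzy : (u * e) * (t * e) = e := by
      rw [mul_assoc, ← mul_assoc e, h1, ← mul_assoc, hu]
    have hz : u * e = s * e := by
      calc u * e = (u * e) * ((t * e) * (s * e)) := by rw [hyx, mul_assoc, hee]
        _ = e * (s * e) := by rw [← mul_assoc, hzy]
        _ = s * e := by rw [← mul_assoc, h1]
    refine ⟨e * (t * e), ?_⟩
    rw [← mul_assoc s, ← hz, hzy, hee]
  let j : G →* Sᵐᵒᵖ :=
    { toFun := fun g => MulOpposite.op (i g⁻¹)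
      map_one' := by simp
      map_mul' := fun a b => by simp }
  have hj : DenseRange j := by
    have hs : Function.Surjective (fun g : G => g⁻¹) := inv_surjective
    have h3 : DenseRange (fun g : G => i g⁻¹) := by
      unfold DenseRange
      rw [show range (fun g : G => i g⁻¹) = range i from hs.range_comp i]
      exact hd
    exact MulOpposite.opHomeomorph.surjective.denseRange.comp h3
      (MulOpposite.continuous_op (M := S))
  have h2 : ∀ s, e * s * e = e * s := fun s => by
    have := jdlg_cancel (S := Sᵐᵒᵖ)
      (fun s => MulOpposite.continuous_op.comp ((hr s.unop).comp MulOpposite.continuous_unop))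
      (fun s => MulOpposite.continuous_op.comp ((hl s.unop).comp MulOpposite.continuous_unop))
      j hj (MulOpposite.op e) (fun s => by
        obtain ⟨t, ht⟩ := he' s.unop
        exact ⟨MulOpposite.op t, MulOpposite.unop_injective (by simpa using ht)⟩)
      (MulOpposite.op (s * e)) (MulOpposite.op s) (MulOpposite.op e)
      (MulOpposite.unop_injective (by simp [mul_assoc, hee]))
    simpa [mul_assoc] using congrArg MulOpposite.unop this
  intro s
  rw [← h1, h2]

section JDLG
variable {G : Type*} [Group G] {V : Type*} [NormedAddCommGroup V] [NormedSpace ℝ V]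

theorem jdlg_eval_continuous (l : StrongDual ℝ V) :
    Continuous (fun x : WeakSpace ℝ V => l ((toWeakSpace ℝ V).symm x)) :=
  WeakBilin.eval_continuous (topDualPairing ℝ V).flip l

theorem jdlg_map_continuous (T : V →L[ℝ] V) :
    Continuous (fun x : WeakSpace ℝ V => toWeakSpace ℝ V (T ((toWeakSpace ℝ V).symm x))) :=
  (WeakSpace.map T).continuous

noncomputable def jdlgEmb (T : V →L[ℝ] V) : V → WeakSpace ℝ V := fun v => toWeakSpace ℝ V (T v)

def jdlgCl (ρ : G →* (V ≃L[ℝ] V)) : Set (V → WeakSpace ℝ V) :=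
  closure (range fun g => jdlgEmb (ρ g : V →L[ℝ] V))

theorem jdlg_mul_mem (ρ : G →* (V ≃L[ℝ] V)) {T R : V →L[ℝ] V} (hT : jdlgEmb T ∈ jdlgCl ρ)
    (hR : jdlgEmb R ∈ jdlgCl ρ) : jdlgEmb (T * R) ∈ jdlgCl ρ := by
  have h1 : ∀ g, jdlgEmb ((ρ g : V →L[ℝ] V) * R) ∈ jdlgCl ρ := by
    intro g
    have hc : Continuous (fun (f : V → WeakSpace ℝ V) v =>
        toWeakSpace ℝ V ((ρ g : V →L[ℝ] V) ((toWeakSpace ℝ V).symm (f v)))) :=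
      continuous_pi fun v => (jdlg_map_continuous _).comp (continuous_apply v)
    suffices hmap : MapsTo (fun (f : V → WeakSpace ℝ V) v =>
        toWeakSpace ℝ V ((ρ g : V →L[ℝ] V) ((toWeakSpace ℝ V).symm (f v)))) (jdlgCl ρ) (jdlgCl ρ) from
      hmap hR
    refine MapsTo.closure ?_ hc
    rintro _ ⟨h, rfl⟩
    refine ⟨g * h, ?_⟩
    funext v
    simp [jdlgEmb]
  have hc : Continuous (fun (f : V → WeakSpace ℝ V) v => f (R v)) :=
    continuous_pi fun v => continuous_apply _
  have := map_mem_closure (t := jdlgCl ρ) hc hT (by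
    rintro _ ⟨h, rfl⟩
    exact h1 h)
  rw [jdlgCl, closure_closure] at this
  exact this

def jdlgSub (ρ : G →* (V ≃L[ℝ] V)) : Submonoid (V →L[ℝ] V) where
  carrier := {T | jdlgEmb T ∈ jdlgCl ρ}
  mul_mem' := fun hT hR => jdlg_mul_mem ρ hT hR
  one_mem' := subset_closure ⟨1, by funext v; simp [jdlgEmb]⟩

def JdlgS (ρ : G →* (V ≃L[ℝ] V)) : Type _ := jdlgSub ρ

instance (ρ : G →* (V ≃L[ℝ] V)) : Monoid (JdlgS ρ) := inferInstanceAs (Monoid (jdlgSub ρ))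

def JdlgS.op {ρ : G →* (V ≃L[ℝ] V)} (s : JdlgS ρ) : V →L[ℝ] V := Subtype.val s

theorem JdlgS.op_mul {ρ : G →* (V ≃L[ℝ] V)} (s t : JdlgS ρ) (v : V) :
    (s * t).op v = s.op (t.op v) := rfl

theorem JdlgS.op_mem {ρ : G →* (V ≃L[ℝ] V)} (s : JdlgS ρ) : jdlgEmb s.op ∈ jdlgCl ρ :=
  Subtype.property s

noncomputable instance (ρ : G →* (V ≃L[ℝ] V)) : TopologicalSpace (JdlgS ρ) :=
  TopologicalSpace.induced (fun s => jdlgEmb s.op) inferInstance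

theorem JdlgS.inj (ρ : G →* (V ≃L[ℝ] V)) :
    Function.Injective (fun s : JdlgS ρ => jdlgEmb s.op) := by
  intro s t h
  apply Subtype.ext
  ext v
  exact (toWeakSpace ℝ V).injective (congrFun h v)

theorem JdlgS.isEmbedding (ρ : G →* (V ≃L[ℝ] V)) :
    IsEmbedding (fun s : JdlgS ρ => jdlgEmb s.op) := ⟨⟨rfl⟩, JdlgS.inj ρ⟩

instance (ρ : G →* (V ≃L[ℝ] V)) : T2Space (JdlgS ρ) := (JdlgS.isEmbedding ρ).t2Space

theorem JdlgS.continuous_apply (ρ : G →* (V ≃L[ℝ] V)) (v : V) :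
    Continuous (fun s : JdlgS ρ => toWeakSpace ℝ V (s.op v)) :=
  (_root_.continuous_apply v).comp (JdlgS.isEmbedding ρ).continuous

theorem JdlgS.continuous_eval (ρ : G →* (V ≃L[ℝ] V)) (v : V) (l : StrongDual ℝ V) :
    Continuous (fun s : JdlgS ρ => l (s.op v)) :=
  (jdlg_eval_continuous l).comp (JdlgS.continuous_apply ρ v)

theorem JdlgS.hl (ρ : G →* (V ≃L[ℝ] V)) (s : JdlgS ρ) : Continuous (fun x => s * x) := by
  rw [(JdlgS.isEmbedding ρ).continuous_iff]
  exact continuous_pi fun v => (jdlg_map_continuous s.op).comp (JdlgS.continuous_apply ρ v)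

theorem JdlgS.hr (ρ : G →* (V ≃L[ℝ] V)) (s : JdlgS ρ) : Continuous (fun x => x * s) := by
  rw [(JdlgS.isEmbedding ρ).continuous_iff]
  exact continuous_pi fun v => JdlgS.continuous_apply ρ (s.op v)

def JdlgS.of (ρ : G →* (V ≃L[ℝ] V)) : G →* JdlgS ρ where
  toFun := fun g => ⟨(ρ g : V →L[ℝ] V), subset_closure ⟨g, rfl⟩⟩
  map_one' := by apply Subtype.ext; ext v; simp; rfl
  map_mul' := fun a b => by apply Subtype.ext; ext v; simp; rfl

theorem JdlgS.of_op (ρ : G →* (V ≃L[ℝ] V)) (g : G) (v : V) : (JdlgS.of ρ g).op v = ρ g v := rfl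

theorem JdlgS.dense (ρ : G →* (V ≃L[ℝ] V)) : DenseRange (JdlgS.of ρ) := by
  intro s
  rw [(JdlgS.isEmbedding ρ).closure_eq_preimage_closure_image]
  have := s.op_mem
  rw [jdlgCl] at this
  rw [mem_preimage, ← range_comp]
  exact this

theorem jdlg_bound [CompleteSpace V] (ρ : G →* (V ≃L[ℝ] V))
    (hwap : ∀ v : V, IsCompact (closure ((toWeakSpace ℝ V) '' (Set.range fun g => ρ g v)))) :
    ∃ M : ℝ, 0 < M ∧ ∀ g v, ‖ρ g v‖ ≤ M * ‖v‖ := by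
  have h1 : ∀ v : V, ∃ C, ∀ g, ‖(ρ g : V →L[ℝ] V) v‖ ≤ C := by
    intro v
    obtain ⟨C, hC⟩ := banach_steinhaus
      (g := fun g : G => NormedSpace.inclusionInDoubleDual ℝ V (ρ g v)) (by
        intro l
        obtain ⟨C, hC⟩ := (((hwap v).image (jdlg_eval_continuous l)).isBounded).exists_norm_le
        refine ⟨C, fun g => hC _ ⟨toWeakSpace ℝ V (ρ g v), subset_closure ⟨_, ⟨g, rfl⟩, rfl⟩, ?_⟩⟩
        simp)
    refine ⟨C, fun g => ?_⟩
    have h2 := hC g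
    have h3 := (NormedSpace.inclusionInDoubleDualLi ℝ (E := V)).norm_map (ρ g v)
    exact (h3.symm.le).trans h2
  obtain ⟨C, hC⟩ := banach_steinhaus h1
  refine ⟨max C 1, by positivity, fun g v => ?_⟩
  refine ((ρ g : V →L[ℝ] V).le_opNorm v).trans ?_
  gcongr
  exact (hC g).trans (le_max_left _ _)

theorem jdlg_compact [CompleteSpace V] (ρ : G →* (V ≃L[ℝ] V))
    (hwap : ∀ v : V, IsCompact (closure ((toWeakSpace ℝ V) '' (Set.range fun g => ρ g v)))) :
    CompactSpace (JdlgS ρ) := by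
  obtain ⟨M, hM, hb⟩ := jdlg_bound ρ hwap
  have hC : IsCompact (jdlgCl ρ) := by
    refine (isCompact_univ_pi hwap).of_isClosed_subset isClosed_closure ?_
    refine closure_minimal ?_ (isClosed_set_pi fun v _ => isClosed_closure)
    rintro _ ⟨g, rfl⟩ v -
    exact subset_closure ⟨_, ⟨g, rfl⟩, rfl⟩
  refine ⟨(JdlgS.isEmbedding ρ).isCompact_iff.2 ?_⟩
  rw [image_univ]
  convert hC
  apply Subset.antisymm
  · rintro _ ⟨s, rfl⟩; exact s.op_mem
  · intro f hf
    have hadd : ∀ v w, f (v + w) = f v + f w := by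
      intro v w
      have hcl : IsClosed {f : V → WeakSpace ℝ V | f (v + w) = f v + f w} :=
        isClosed_eq (continuous_apply _) (Continuous.add (continuous_apply v) (continuous_apply w))
      refine closure_minimal ?_ hcl hf
      rintro _ ⟨g, rfl⟩
      simp [jdlgEmb]
    have hsmul : ∀ (c : ℝ) v, f (c • v) = c • f v := by
      intro c v
      have hcl : IsClosed {f : V → WeakSpace ℝ V | f (c • v) = c • f v} :=
        isClosed_eq (continuous_apply _) ((continuous_apply _).const_smul c)
      refine closure_minimal ?_ hcl hf
      rintro _ ⟨g, rfl⟩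
      simp [jdlgEmb]
    have hbd : ∀ v, ‖(toWeakSpace ℝ V).symm (f v)‖ ≤ M * ‖v‖ := by
      intro v
      refine NormedSpace.norm_le_dual_bound ℝ _ (by positivity) fun l => ?_
      have hcl : IsClosed {f : V → WeakSpace ℝ V |
          ‖l ((toWeakSpace ℝ V).symm (f v))‖ ≤ M * ‖v‖ * ‖l‖} :=
        isClosed_le ((jdlg_eval_continuous l).comp (continuous_apply v)).norm continuous_const
      refine closure_minimal ?_ hcl hf
      rintro _ ⟨g, rfl⟩
      have := l.le_opNorm (ρ g v)
      have h2 := mul_le_mul_of_nonneg_left (hb g v) (norm_nonneg l)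
      simp only [jdlgEmb, mem_ofPred_eq, LinearEquiv.symm_apply_apply]
      show ‖l (ρ g v)‖ ≤ _
      linarith
    let T : V →L[ℝ] V := LinearMap.mkContinuous
      { toFun := fun v => (toWeakSpace ℝ V).symm (f v)
        map_add' := fun v w => by rw [hadd, map_add]
        map_smul' := fun c v => by rw [hsmul, map_smul]; rfl } M hbd
    have hT : jdlgEmb T = f := by
      funext v; simp [jdlgEmb, T]
    exact ⟨⟨T, show jdlgEmb T ∈ jdlgCl ρ from hT ▸ hf⟩, hT⟩

theorem jdlg_ap [CompleteSpace V] (ρ : G →* (V ≃L[ℝ] V))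
    (hwap : ∀ v : V, IsCompact (closure ((toWeakSpace ℝ V) '' (Set.range fun g => ρ g v))))
    (e : JdlgS ρ) (hee : e * e = e) (he : ∀ s, ∃ t, t * s * e = e) (v : V) :
    IsCompact (closure (range fun g => ρ g (e.op v))) := by
  obtain ⟨M, hM, hb⟩ := jdlg_bound ρ hwap
  have := jdlg_compact ρ hwap
  have hr := JdlgS.hr ρ
  have hl := JdlgS.hl ρ
  let Q := range (fun x => x * e)
  have : CompactSpace Q := isCompact_iff_compactSpace.1 (isCompact_range (hr e))
  let a : G → Q → Q := fun g q => ⟨JdlgS.of ρ g * q.1, by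
    obtain ⟨_, w, rfl⟩ := q; exact ⟨JdlgS.of ρ g * w, mul_assoc _ _ _⟩⟩
  have hmin : ∀ q, DenseRange (fun g => a g q) := by
    rintro ⟨_, w, rfl⟩
    rw [DenseRange, dense_iff_inter_open]
    rintro _ ⟨U, hU, rfl⟩ ⟨⟨_, v, rfl⟩, hv⟩
    obtain ⟨t, ht⟩ := he w
    have : v * t ∈ (fun s => s * (w * e)) ⁻¹' U := by
      show v * t * (w * e) ∈ U
      rw [mul_assoc, ← mul_assoc t, ht]; exact hv
    obtain ⟨g, hg⟩ := (JdlgS.dense ρ).exists_mem_open (hU.preimage (hr (w * e))) ⟨_, this⟩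
    exact ⟨_, hg, g, rfl⟩
  let K : Set (WeakDual ℝ V) := WeakDual.toStrongDual ⁻¹' Metric.closedBall (0 : StrongDual ℝ V) 1
  have : CompactSpace K := isCompact_iff_compactSpace.1 (WeakDual.isCompact_closedBall _ _)
  let F : Q → K → ℝ := fun q k => k.1 (q.1.op v)
  have hinv : ∀ g k, ∃ k', ∀ q, F q k = M * F (a g q) k' := by
    rintro g ⟨k, hk⟩
    let l : StrongDual ℝ V := M⁻¹ • ((WeakDual.toStrongDual k).comp (ρ g⁻¹ : V →L[ℝ] V))
    have hk' : ‖WeakDual.toStrongDual k‖ ≤ 1 := by simpa [K] using hk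
    have hnl : ‖l‖ ≤ 1 := by
      refine ContinuousLinearMap.opNorm_le_bound _ zero_le_one fun w => ?_
      have h1 := (WeakDual.toStrongDual k).le_opNorm (ρ g⁻¹ w)
      have h2 := hb g⁻¹ w
      have h3 : ‖WeakDual.toStrongDual k (ρ g⁻¹ w)‖ ≤ M * ‖w‖ := by
        refine h1.trans ?_
        have := mul_le_mul_of_nonneg_right hk' (norm_nonneg (ρ g⁻¹ w))
        linarith
      have h4 : l w = M⁻¹ * WeakDual.toStrongDual k (ρ g⁻¹ w) := rfl
      rw [h4, norm_mul, norm_inv, Real.norm_of_nonneg hM.le, inv_mul_le_iff₀ hM]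
      linarith
    refine ⟨⟨StrongDual.toWeakDual l, by simpa [K] using hnl⟩, fun q => ?_⟩
    show k (q.1.op v) = M * (M⁻¹ * k (ρ g⁻¹ (ρ g (q.1.op v))))
    have : ρ g⁻¹ (ρ g (q.1.op v)) = q.1.op v := by
      have h5 := congrArg (fun f : V ≃L[ℝ] V => f (q.1.op v)) (map_mul ρ g⁻¹ g)
      rw [inv_mul_cancel, map_one] at h5
      exact h5.symm
    rw [this, mul_inv_cancel_left₀ hM.ne']
  have hcont : Continuous (fun q : Q => q.1.op v) := by
    rw [continuous_iff_continuousAt]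
    intro q
    rw [Metric.continuousAt_iff']
    intro ε hε
    obtain ⟨U, hU, hqU, hUε⟩ := jdlg_equi F
      (fun q => (WeakDual.eval_continuous _).comp continuous_subtype_val)
      (fun k => (JdlgS.continuous_eval ρ v (WeakDual.toStrongDual k.1)).comp continuous_subtype_val)
      a (fun g => ((hl _).comp continuous_subtype_val).subtype_mk _) M hM hinv hmin
      (ε / 2) (by positivity) q
    filter_upwards [hU.mem_nhds hqU] with p hp
    rw [dist_eq_norm]
    refine lt_of_le_of_lt ?_ (half_lt_self hε)
    obtain ⟨l, hl1, hl2⟩ := exists_dual_vector'' ℝ (p.1.op v - q.1.op v)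
    have := hUε p hp q hqU ⟨StrongDual.toWeakDual l, by simpa [K] using hl1⟩
    have h2 : l (p.1.op v) - l (q.1.op v) = ‖p.1.op v - q.1.op v‖ := by
      rw [← map_sub, hl2]; rfl
    have h3 : |l (p.1.op v) - l (q.1.op v)| ≤ ε / 2 := this
    rw [h2] at h3
    exact (le_abs_self _).trans h3
  refine (isCompact_range hcont).closure_of_subset ?_
  rintro _ ⟨g, rfl⟩
  exact ⟨⟨JdlgS.of ρ g * e, _, rfl⟩, rfl⟩

end JDLG


end


/-!
Statement 13 (Jacobs–de Leeuw–Glicksberg decomposition): Let `V` be a Banach space and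
`ρ : G → GL(V)` a weakly almost periodic representation of a group `G`. Then `V` decomposes
as a topological direct sum `V = V₁ ⊕ V₂` of closed `G`-invariant linear subspaces, where
`V₁` is exactly the set of almost periodic vectors (relatively norm-compact orbit) and `V₂`
is exactly the set of furtive vectors (`0` in the weak closure of the orbit).
-/

theorem jacobs_deLeeuw_glicksberg_decomposition
    {G : Type*} [Group G]
    {V : Type*} [NormedAddCommGroup V] [NormedSpace ℝ V] [CompleteSpace V]
    (ρ : G →* (V ≃L[ℝ] V))
    -- `ρ` is weakly almost periodic:
    (hwap : ∀ v : V, IsCompact (closure ((toWeakSpace ℝ V) '' (Set.range fun g => ρ g v)))) :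
    ∃ V₁ V₂ : Submodule ℝ V,
      -- closed subspaces:
      IsClosed (V₁ : Set V) ∧ IsClosed (V₂ : Set V) ∧
      -- `G`-invariant:
      (∀ g : G, ∀ v ∈ V₁, ρ g v ∈ V₁) ∧ (∀ g : G, ∀ v ∈ V₂, ρ g v ∈ V₂) ∧
      -- a direct sum decomposition `V = V₁ ⊕ V₂` ...
      IsCompl V₁ V₂ ∧
      -- ... which is topological: the projection onto `V₁` along `V₂` is bounded:
      (∃ p : V →L[ℝ] V, (∀ v ∈ V₁, p v = v) ∧ (∀ v ∈ V₂, p v = 0)) ∧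
      -- `V₁` is the set of almost periodic vectors:
      (V₁ : Set V) = {v | IsCompact (closure (Set.range fun g => ρ g v))} ∧
      -- `V₂` is the set of furtive vectors:
      (V₂ : Set V) =
        {v | (0 : WeakSpace ℝ V) ∈ closure ((toWeakSpace ℝ V) '' (Set.range fun g => ρ g v))} := by
  obtain ⟨M, hM, hb⟩ := jdlg_bound ρ hwap
  have := jdlg_compact ρ hwap
  obtain ⟨e, hee, he, hcomm⟩ := jdlg_semigroup (JdlgS.hl ρ) (JdlgS.hr ρ) (JdlgS.of ρ) (JdlgS.dense ρ)
  let p : V →L[ℝ] V := e.op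
  have hpp : ∀ v, p (p v) = p v := fun v => by
    show e.op (e.op v) = e.op v
    rw [← JdlgS.op_mul, hee]
  have hpg : ∀ g v, p (ρ g v) = ρ g (p v) := fun g v => by
    show e.op ((JdlgS.of ρ g).op v) = (JdlgS.of ρ g).op (e.op v)
    rw [← JdlgS.op_mul, ← JdlgS.op_mul, hcomm]
  have hap : ∀ v, IsCompact (closure (Set.range fun g => ρ g (p v))) := jdlg_ap ρ hwap e hee he
  have hk1 : ∀ v, p v = 0 →
      (0 : WeakSpace ℝ V) ∈ closure ((toWeakSpace ℝ V) '' (Set.range fun g => ρ g v)) := by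
    intro v hv
    have h := map_mem_closure (t := (toWeakSpace ℝ V) '' (Set.range fun g => ρ g v))
      (JdlgS.continuous_apply ρ v) (JdlgS.dense ρ e) (by
        rintro _ ⟨g, rfl⟩
        exact ⟨_, ⟨g, rfl⟩, rfl⟩)
    have h0 : e.op v = 0 := hv
    rw [h0, map_zero] at h
    exact h
  have hk2 : ∀ v, (0 : WeakSpace ℝ V) ∈ closure ((toWeakSpace ℝ V) '' (Set.range fun g => ρ g v)) →
      p v = 0 := by
    intro v hv
    have hcl : IsClosed (Set.range fun s : JdlgS ρ => toWeakSpace ℝ V (s.op v)) :=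
      (isCompact_range (JdlgS.continuous_apply ρ v)).isClosed
    obtain ⟨s, hs⟩ := closure_minimal (by
      rintro _ ⟨_, ⟨g, rfl⟩, rfl⟩
      exact ⟨JdlgS.of ρ g, rfl⟩) hcl hv
    have hs0 : s.op v = 0 := (toWeakSpace ℝ V).injective (by rw [map_zero]; exact hs)
    obtain ⟨t, ht⟩ := he s
    show e.op v = 0
    rw [← ht, mul_assoc, hcomm, JdlgS.op_mul, JdlgS.op_mul, hs0, map_zero, map_zero]
  have hz : ∀ w, IsCompact (closure (Set.range fun g => ρ g w)) → p w = 0 → w = 0 := by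
    intro w hw hpw
    have h0 := hk1 w hpw
    have hcl : IsClosed (toWeakSpace ℝ V '' closure (Set.range fun g => ρ g w)) :=
      (hw.image (toWeakSpaceCLM ℝ V).continuous).isClosed
    obtain ⟨u, hu, hu0⟩ := closure_minimal (Set.image_mono subset_closure) hcl h0
    have hu1 : u = 0 := (toWeakSpace ℝ V).injective (by rw [map_zero]; exact hu0)
    subst hu1
    by_contra hne
    have hpos : 0 < ‖w‖ := norm_pos_iff.2 hne
    obtain ⟨_, ⟨g, rfl⟩, hg⟩ := Metric.mem_closure_iff.1 hu (‖w‖ / M) (by positivity)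
    rw [dist_zero_left, lt_div_iff₀ hM] at hg
    have h3 := hb g⁻¹ (ρ g w)
    have h4 : ρ g⁻¹ (ρ g w) = w := by
      have h5 := congrArg (fun f : V ≃L[ℝ] V => f (w)) (map_mul ρ g⁻¹ g)
      rw [inv_mul_cancel, map_one] at h5
      exact h5.symm
    rw [h4] at h3
    linarith
  have hfix : ∀ v, IsCompact (closure (Set.range fun g => ρ g v)) → p v = v := by
    intro v hv
    have hw : IsCompact (closure (Set.range fun g => ρ g (v - p v))) := by
      refine ((hv.prod (hap v)).image (continuous_fst.sub continuous_snd)).closure_of_subset ?_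
      rintro _ ⟨g, rfl⟩
      exact ⟨(ρ g v, ρ g (p v)), ⟨subset_closure ⟨g, rfl⟩, subset_closure ⟨g, rfl⟩⟩, by simp⟩
    have := hz _ hw (by rw [map_sub, hpp, sub_self])
    exact (sub_eq_zero.1 this).symm
  refine ⟨LinearMap.ker ((ContinuousLinearMap.id ℝ V - p : V →L[ℝ] V) : V →ₗ[ℝ] V),
    LinearMap.ker (p : V →ₗ[ℝ] V), ?_, ?_, ?_, ?_, ?_, ⟨p, ?_, ?_⟩, ?_, ?_⟩
  · exact ContinuousLinearMap.isClosed_ker (ContinuousLinearMap.id ℝ V - p)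
  · exact ContinuousLinearMap.isClosed_ker p
  · intro g v hv
    simp only [LinearMap.mem_ker, ContinuousLinearMap.coe_coe, _root_.sub_apply,
      ContinuousLinearMap.id_apply, sub_eq_zero] at hv ⊢
    rw [hpg, ← hv]
  · intro g v hv
    simp only [LinearMap.mem_ker, ContinuousLinearMap.coe_coe] at hv ⊢
    rw [hpg, hv, map_zero]
  · rw [isCompl_iff, Submodule.disjoint_def, codisjoint_iff, Submodule.eq_top_iff']
    constructor
    · intro v hv hv2
      simp only [LinearMap.mem_ker, ContinuousLinearMap.coe_coe, _root_.sub_apply,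
        ContinuousLinearMap.id_apply, sub_eq_zero] at hv hv2
      rw [hv, hv2]
    · intro v
      rw [Submodule.mem_sup]
      refine ⟨p v, ?_, v - p v, ?_, by abel⟩
      · simp [hpp]
      · simp [hpp]
  · intro v hv
    simp only [LinearMap.mem_ker, ContinuousLinearMap.coe_coe, _root_.sub_apply,
      ContinuousLinearMap.id_apply, sub_eq_zero] at hv
    exact hv.symm
  · intro v hv
    exact hv
  · ext v
    simp only [SetLike.mem_coe, LinearMap.mem_ker, ContinuousLinearMap.coe_coe,
      _root_.sub_apply, ContinuousLinearMap.id_apply, sub_eq_zero, Set.mem_ofPred_eq]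
    constructor
    · intro hv
      have h := hap v
      rwa [← hv] at h
    · intro hv
      exact (hfix v hv).symm
  · ext v
    exact ⟨hk1 v, hk2 v⟩
end

section
/- (Troallic) Let S be a compact semitopological semigroup containing a dense subsemigroup that is algebraically a group. Then S contains a unique minimal two-sided ideal K(S) (the Sushkevich kernel), and K(S), equipped with the subspace topology and the restricted multiplication, is a compact topological group: multiplication on K(S) is jointly continuous, K(S) has an identity, and inversion is continuous. -/
/-- A two-sided ideal of a semigroup: a nonempty subset `I` with `SI ⊆ I` and `IS ⊆ I`. -/
def IsTwoSidedIdeal' {S : Type*} [Mul S] (I : Set S) : Prop :=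
  I.Nonempty ∧ ∀ a : S, ∀ x ∈ I, a * x ∈ I ∧ x * a ∈ I

/-- A minimal two-sided ideal: one containing no proper two-sided ideal. -/
def IsMinimalTwoSidedIdeal {S : Type*} [Mul S] (I : Set S) : Prop :=
  IsTwoSidedIdeal' I ∧ ∀ J : Set S, IsTwoSidedIdeal' J → J ⊆ I → J = I

open Set Topology

theorem sepLemma {X Y : Type*} [TopologicalSpace X] [CompactSpace X]
    [TopologicalSpace Y] [CompactSpace Y] (F : X → Y → ℝ)
    (h1 : ∀ y, Continuous fun x => F x y) (h2 : ∀ x, Continuous (F x))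
    (B : Set Y) (hB : B.Countable) (hBd : Dense B) (ε : ℝ) (hε : 0 < ε) :
    ∃ n : X → ℕ, ∀ x x', n x = n x' → ∀ y, |F x y - F x' y| < ε := by
  have : Countable B := hB.to_subtype
  let T : X → (B → ℝ) := fun x b => F x b
  have hT : Continuous T := continuous_pi fun b => h1 b
  obtain ⟨Q0, hQ0c, hQ0d⟩ := TopologicalSpace.exists_countable_dense (range T)
  let Q : Set X := (fun p : range T => p.2.choose) '' Q0
  have hQc : Q.Countable := hQ0c.image _
  have : Countable Q := hQc.to_subtype
  have hTQ : ∀ x, ∃ x' ∈ closure Q, T x' = T x := by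
    intro x
    have hcl : IsClosed (T '' closure Q) := (isClosed_closure.isCompact.image hT).isClosed
    have h3 : (⟨T x, x, rfl⟩ : range T) ∈ closure Q0 := hQ0d _
    have h4 : closure Q0 ⊆ Subtype.val ⁻¹' (T '' closure Q) := by
      apply closure_minimal _ (hcl.preimage continuous_subtype_val)
      intro p hp
      exact ⟨p.2.choose, subset_closure ⟨p, hp, rfl⟩, p.2.choose_spec⟩
    exact h4 h3
  let Ψ : Y → (Q → ℝ) := fun y q => F q y
  have hΨ : Continuous Ψ := continuous_pi fun q => h2 q
  have hfac : ∀ x y y', Ψ y = Ψ y' → F x y = F x y' := by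
    intro x y y' h
    obtain ⟨x', hx', hxx⟩ := hTQ x
    have e1 : F x' = F x := by
      apply Continuous.ext_on hBd (h2 _) (h2 _)
      intro b hb
      exact congrFun hxx ⟨b, hb⟩
    have e2 : closure Q ⊆ {u | F u y = F u y'} := by
      apply closure_minimal _ (isClosed_eq (h1 _) (h1 _))
      intro q hq
      exact congrFun h ⟨q, hq⟩
    rw [← e1]; exact e2 hx'
  let π : Y → range Ψ := rangeFactorization Ψ
  have hπ : Continuous π := hΨ.subtype_mk _
  have hπq : IsQuotientMap π :=
    hπ.isClosedMap.isQuotientMap hπ rangeFactorization_surjective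
  have : CompactSpace (range Ψ) := isCompact_iff_compactSpace.mp (isCompact_range hΨ)
  have hG : ∀ x, ∃ G : C(range Ψ, ℝ), ∀ y, G (π y) = F x y := by
    intro x
    let f : C(Y, ℝ) := ⟨F x, h2 x⟩
    have hff : Function.FactorsThrough f (⟨π, hπ⟩ : C(Y, range Ψ)) := by
      intro a b hab
      exact hfac x a b (congrArg Subtype.val hab)
    refine ⟨IsQuotientMap.lift (f := ⟨π, hπ⟩) hπq f hff, fun y => ?_⟩
    exact DFunLike.congr_fun (IsQuotientMap.lift_comp (f := ⟨π, hπ⟩) hπq f hff) y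
  choose G hG using hG
  have hc : ∀ x, ∃ n, dist (G x) (TopologicalSpace.denseSeq C(range Ψ, ℝ) n) < ε / 2 := by
    intro x
    exact (TopologicalSpace.denseRange_denseSeq C(range Ψ, ℝ)).exists_dist_lt _ (half_pos hε)
  choose n hn using hc
  refine ⟨n, fun x x' h y => ?_⟩
  rw [← hG x y, ← hG x' y, ← Real.dist_eq]
  have a1 := hn x
  have a2 := hn x'
  rw [← h, dist_comm] at a2
  calc _ ≤ dist (G x) (G x') := ContinuousMap.dist_apply_le_dist _
    _ ≤ _ := dist_triangle _ _ _
    _ < ε := by linarith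

theorem sepLemma' {X Y : Type*} [TopologicalSpace X] [CompactSpace X]
    [TopologicalSpace Y] [CompactSpace Y] (F : X → Y → ℝ)
    (h1 : ∀ y, Continuous fun x => F x y) (h2 : ∀ x, Continuous (F x))
    (B : Set Y) (hB : B.Countable) (ε : ℝ) (hε : 0 < ε) :
    ∃ n : X → ℕ, ∀ x x', n x = n x' → ∀ y ∈ B, |F x y - F x' y| < ε := by
  have : CompactSpace (closure B) := isCompact_iff_compactSpace.mp isClosed_closure.isCompact
  obtain ⟨n, hn⟩ := sepLemma (fun x (y : closure B) => F x y) (fun y => h1 y)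
    (fun x => (h2 x).comp continuous_subtype_val) (Subtype.val ⁻¹' B)
    (hB.preimage Subtype.val_injective)
    (by
      intro y
      rw [closure_subtype, Subtype.image_preimage_coe, inter_eq_right.2 subset_closure]
      exact y.2) ε hε
  exact ⟨n, fun x x' h y hy => hn x x' h ⟨y, subset_closure hy⟩⟩

theorem fragLemma {X Y : Type*} [TopologicalSpace X] [CompactSpace X] [T2Space X] [Nonempty X]
    [TopologicalSpace Y] [CompactSpace Y] (F : X → Y → ℝ)
    (h1 : ∀ y, Continuous fun x => F x y) (h2 : ∀ x, Continuous (F x))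
    (ε : ℝ) (hε : 0 < ε) :
    ∃ V : Set X, IsOpen V ∧ V.Nonempty ∧ ∀ x ∈ V, ∀ x' ∈ V, ∀ y, |F x y - F x' y| ≤ ε := by
  by_contra hcon
  push Not at hcon
  let P := {V : Set X // IsOpen V ∧ V.Nonempty}
  have hnb : ∀ (V : Set X) (x : X) (y : Y), IsOpen V → x ∈ V →
      ∃ U : P, closure U.1 ⊆ V ∧ ∀ u ∈ U.1, |F u y - F x y| < ε / 4 := by
    intro V x y hV hx
    have hO : IsOpen (V ∩ {u | |F u y - F x y| < ε / 4}) :=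
      hV.inter (isOpen_lt (((h1 y).sub continuous_const).abs) continuous_const)
    have hm : x ∈ V ∩ {u | |F u y - F x y| < ε / 4} := ⟨hx, by simpa using hε⟩
    obtain ⟨K, hK, hKc, hKs⟩ := exists_mem_nhds_isClosed_subset (hO.mem_nhds hm)
    refine ⟨⟨interior K, isOpen_interior, x, mem_interior_iff_mem_nhds.2 hK⟩, ?_, ?_⟩
    · exact (closure_minimal interior_subset hKc).trans fun u hu => (hKs hu).1
    · intro u hu
      exact (hKs (interior_subset hu)).2
  have hstep : ∀ V : P, ∃ (g : Bool → P) (y : Y), (∀ b, closure (g b).1 ⊆ V.1) ∧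
      ∀ x ∈ (g false).1, ∀ x' ∈ (g true).1, ε / 2 < |F x y - F x' y| := by
    intro V
    obtain ⟨x, hx, x', hx', y, hy⟩ := hcon V.1 V.2.1 V.2.2
    obtain ⟨U, hU, hU'⟩ := hnb V.1 x y V.2.1 hx
    obtain ⟨U₂, hU₂, hU₂'⟩ := hnb V.1 x' y V.2.1 hx'
    refine ⟨fun b => if b then U₂ else U, y, ?_, ?_⟩
    · intro b; cases b <;> simpa
    · intro u hu u' hu'
      simp only [Bool.false_eq_true, if_false, if_true] at hu hu'
      have a1 := abs_lt.1 (hU' u hu)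
      have a2 := abs_lt.1 (hU₂' u' hu')
      rw [lt_abs] at hy ⊢
      rcases hy with hy | hy
      · left; linarith
      · right; linarith
  choose g y hg hy using hstep
  let W : List Bool → P := fun l => List.rec ⟨univ, isOpen_univ, univ_nonempty⟩ (fun b _ V => g V b) l
  have hW : ∀ b l, W (b :: l) = g (W l) b := fun _ _ => rfl
  let p : (ℕ → Bool) → ℕ → List Bool := fun α n => Nat.rec [] (fun k l => α k :: l) n
  have hp : ∀ α n, p α (n + 1) = α n :: p α n := fun _ _ => rfl
  have hx : ∀ α, ∃ x, ∀ n, x ∈ (W (p α n)).1 := by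
    intro α
    have := IsCompact.nonempty_iInter_of_sequence_nonempty_isCompact_isClosed
      (fun n => closure (W (p α n)).1) (fun n => by
        rw [hp, hW]; exact (hg _ _).trans subset_closure)
      (fun n => (W (p α n)).2.2.closure) isClosed_closure.isCompact (fun n => isClosed_closure)
    obtain ⟨x, hx⟩ := this
    rw [mem_iInter] at hx
    refine ⟨x, fun n => ?_⟩
    have := hx (n + 1)
    rw [hp, hW] at this
    exact hg _ _ this
  choose x hx using hx
  obtain ⟨n, hn⟩ := sepLemma' F h1 h2 (range fun l => y (W l)) (countable_range _) (ε / 2) (half_pos hε)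
  have hni : Function.Injective (fun α => n (x α)) := by
    intro α β hab
    by_contra hne
    have hex : ∃ k, α k ≠ β k := Function.ne_iff.1 hne
    classical
    let k := Nat.find hex
    have hk : α k ≠ β k := Nat.find_spec hex
    have hlt : ∀ m < k, α m = β m := fun m hm => not_not.1 (Nat.find_min hex hm)
    have hpk : ∀ m ≤ k, p α m = p β m := by
      intro m
      induction m with
      | zero => intro _; rfl
      | succ m ih =>
        intro hm
        rw [hp, hp, ih (by omega), hlt m (by omega)]
    have b1 := hx α (k + 1)
    have b2 := hx β (k + 1)
    rw [hp, hW] at b1 b2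
    rw [hpk k le_rfl] at b1
    have hlt2 := hn _ _ hab (y (W (p β k))) ⟨_, rfl⟩
    rcases ha : α k with _ | _ <;> rcases hb : β k with _ | _ <;> rw [ha] at b1 <;> rw [hb] at b2
    · exact hk (ha.trans hb.symm)
    · exact absurd (hy _ _ b1 _ b2) (not_lt.2 hlt2.le)
    · rw [abs_sub_comm] at hlt2
      exact absurd (hy _ _ b2 _ b1) (not_lt.2 hlt2.le)
    · exact hk (ha.trans hb.symm)
  classical
  refine Function.cantor_injective (fun s : Set ℕ => n (x fun i => decide (i ∈ s))) ?_
  intro s t hst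
  have := hni hst
  ext i
  simpa using congrFun this i

section
variable {S : Type*} [Semigroup S] [TopologicalSpace S] [CompactSpace S] [T2Space S]

theorem equiLemma
    (hl : ∀ a : S, Continuous fun x => a * x)
    (hr : ∀ a : S, Continuous fun x => x * a)
    (D : Set S) (hD : Dense D) (hinv : ∀ d ∈ D, ∃ d' : S, ∀ x, d' * (d * x) = x)
    (L : Set S) (hLc : IsClosed L) (hL : ∀ s, ∀ x ∈ L, s * x ∈ L)
    (hmin : ∀ x ∈ L, ∀ y ∈ L, ∃ s, s * x = y)
    (f : S → ℝ) (hf : Continuous f) (ε : ℝ) (hε : 0 < ε) (z : S) (hz : z ∈ L) :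
    ∃ W : Set S, IsOpen W ∧ z ∈ W ∧ ∀ w ∈ W, w ∈ L → ∀ t, |f (t * w) - f (t * z)| ≤ ε := by
  have : CompactSpace L := isCompact_iff_compactSpace.mp hLc.isCompact
  have : Nonempty L := ⟨⟨z, hz⟩⟩
  obtain ⟨V, hVo, ⟨v, hv⟩, hV⟩ := fragLemma (fun (x : L) (s : S) => f (s * x))
    (fun s => hf.comp ((hl s).comp continuous_subtype_val)) (fun x => hf.comp (hr x)) ε hε
  obtain ⟨V', hV'o, rfl⟩ := isOpen_induced_iff.1 hVo
  obtain ⟨s, hs⟩ := hmin z hz v v.2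
  obtain ⟨d, hdV, hd⟩ := hD.inter_open_nonempty _ (hV'o.preimage (hr z)) ⟨s, by
    show s * z ∈ V'
    rw [hs]; exact hv⟩
  obtain ⟨d', hd'⟩ := hinv d hd
  refine ⟨(fun x => d * x) ⁻¹' V', hV'o.preimage (hl d), hdV, fun w hw hwL t => ?_⟩
  have := hV ⟨d * w, hL d w hwL⟩ hw ⟨d * z, hL d z hz⟩ hdV (t * d')
  simpa [mul_assoc, hd'] using this

theorem injLemma
    (hl : ∀ a : S, Continuous fun x => a * x)
    (hr : ∀ a : S, Continuous fun x => x * a)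
    (D : Set S) (hD : Dense D) (hinv : ∀ d ∈ D, ∃ d' : S, ∀ x, d' * (d * x) = x)
    (L : Set S) (hLc : IsClosed L) (hL : ∀ s, ∀ x ∈ L, s * x ∈ L)
    (hmin : ∀ x ∈ L, ∀ y ∈ L, ∃ s, s * x = y)
    (s x y : S) (hx : x ∈ L) (hy : y ∈ L) (h : s * x = s * y) : x = y := by
  by_contra hne
  obtain ⟨f, hf0, hf1, -⟩ := exists_continuous_zero_one_of_isClosed (isClosed_singleton (x := x))
    (isClosed_singleton (x := y)) (by simpa using hne)
  obtain ⟨W, hWo, hzW, hW⟩ := equiLemma hl hr D hD hinv L hLc hL hmin f f.continuous (1/4)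
    (by norm_num) (s * x) (hL s x hx)
  obtain ⟨d, ⟨hd1, hd2⟩, hd⟩ := hD.inter_open_nonempty _
    ((hWo.preimage (hr x)).inter (hWo.preimage (hr y))) ⟨s, hzW, by
      show s * y ∈ W
      rw [← h]; exact hzW⟩
  obtain ⟨d', hd'⟩ := hinv d hd
  have a1 := hW _ hd1 (hL d x hx) d'
  have a2 := hW _ hd2 (hL d y hy) d'
  simp only [hd'] at a1 a2
  have e1 : f x = 0 := hf0 rfl
  have e2 : f y = 1 := hf1 rfl
  rw [e1] at a1
  rw [e2] at a2
  rw [abs_le] at a1 a2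
  linarith [a1.1, a1.2, a2.1, a2.2]

theorem jointLemma
    (hl : ∀ a : S, Continuous fun x => a * x)
    (hr : ∀ a : S, Continuous fun x => x * a)
    (D : Set S) (hD : Dense D) (hinv : ∀ d ∈ D, ∃ d' : S, ∀ x, d' * (d * x) = x)
    (L : Set S) (hLc : IsClosed L) (hL : ∀ s, ∀ x ∈ L, s * x ∈ L)
    (hmin : ∀ x ∈ L, ∀ y ∈ L, ∃ s, s * x = y) :
    Continuous fun p : L × L => (p.1 : S) * (p.2 : S) := by
  rw [continuous_iff_continuousAt]
  rintro ⟨s, x⟩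
  rw [ContinuousAt, tendsto_nhds]
  intro U hU hm
  obtain ⟨f, hf0, hf1, -⟩ := exists_continuous_zero_one_of_isClosed
    (isClosed_singleton (x := (s : S) * x)) hU.isClosed_compl (by simpa using hm)
  obtain ⟨W, hWo, hzW, hW⟩ := equiLemma hl hr D hD hinv L hLc hL hmin f f.continuous (1/4)
    (by norm_num) x x.2
  have e0 : f (s * x) = 0 := hf0 rfl
  have hN : IsOpen {t : S | f (t * x) < 1/4} :=
    isOpen_lt (f.continuous.comp (hr x)) continuous_const
  have c1 : {t : L | f ((t : S) * x) < 1/4} ∈ 𝓝 s :=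
    (hN.preimage continuous_subtype_val).mem_nhds (by simp [e0])
  have c2 : {t : L | (t : S) ∈ W} ∈ 𝓝 x :=
    (hWo.preimage continuous_subtype_val).mem_nhds hzW
  filter_upwards [prod_mem_nhds c1 c2]
  rintro ⟨t, w⟩ ⟨ht, hw⟩
  by_contra hn
  have e1 : f (t * w) = 1 := hf1 hn
  have a := (abs_le.1 (hW w hw w.2 t)).2
  have ht' : f ((t : S) * x) < 1/4 := ht
  linarith

/-- existence of a minimal left ideal -/
theorem minLeft [Nonempty S]
    (hr : ∀ a : S, Continuous fun x => x * a) :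
    ∃ L : Set S, L.Nonempty ∧ IsClosed L ∧ (∀ s, ∀ x ∈ L, s * x ∈ L) ∧
      ∀ x ∈ L, ∀ y ∈ L, ∃ s ∈ L, s * x = y := by
  obtain ⟨L, hL⟩ := zorn_superset
    {L : Set S | L.Nonempty ∧ IsClosed L ∧ ∀ s, ∀ x ∈ L, s * x ∈ L} (by
    intro c hc hchain
    rcases c.eq_empty_or_nonempty with rfl | hne
    · exact ⟨univ, ⟨univ_nonempty, isClosed_univ, fun _ _ _ => trivial⟩, by simp⟩
    refine ⟨⋂₀ c, ⟨?_, ?_, ?_⟩, fun s hs => sInter_subset_of_mem hs⟩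
    · have := hne.to_subtype
      apply IsCompact.nonempty_sInter_of_directed_nonempty_isCompact_isClosed
        (fun a ha b hb => ?_) (fun L hL => (hc hL).1)
        (fun L hL => (hc hL).2.1.isCompact) (fun L hL => (hc hL).2.1)
      rcases hchain.total ha hb with h | h
      · exact ⟨a, ha, Subset.rfl, h⟩
      · exact ⟨b, hb, h, Subset.rfl⟩
    · exact isClosed_sInter fun L hL => (hc hL).2.1
    · intro s x hx L hL
      exact (hc hL).2.2 s x (hx L hL))
  obtain ⟨h1, h2, h3⟩ := hL.prop
  refine ⟨L, h1, h2, h3, fun x hx y hy => ?_⟩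
  have hmem : (fun s => s * x) '' L ∈
      {L : Set S | L.Nonempty ∧ IsClosed L ∧ ∀ s, ∀ x ∈ L, s * x ∈ L} := by
    refine ⟨h1.image _, (h2.isCompact.image (hr x)).isClosed, ?_⟩
    rintro s _ ⟨u, hu, rfl⟩
    exact ⟨s * u, h3 _ _ hu, mul_assoc _ _ _⟩
  have := hL.le_of_le hmem (by
    rintro _ ⟨u, hu, rfl⟩
    exact h3 _ _ hx) hy
  exact this

theorem kernelLemma [Nonempty S]
    (hl : ∀ a : S, Continuous fun x => a * x)
    (hr : ∀ a : S, Continuous fun x => x * a)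
    (D : Set S) (hD : Dense D) (hinv : ∀ d ∈ D, ∃ d' : S, ∀ x, d' * (d * x) = x)
    (hinv' : ∀ d ∈ D, ∃ d' : S, ∀ x, (x * d) * d' = x) :
    ∃ L : Set S, IsClosed L ∧ (∀ s, ∀ x ∈ L, s * x ∈ L ∧ x * s ∈ L) ∧
      Continuous (fun p : L × L => (p.1 : S) * (p.2 : S)) ∧
      ∃ e ∈ L, (∀ x ∈ L, e * x = x ∧ x * e = x) ∧ ∀ x ∈ L, ∃ y ∈ L, x * y = e ∧ y * x = e := by
  obtain ⟨L, hne, hLc, hL, hmin⟩ := minLeft hr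
  have hmin' : ∀ x ∈ L, ∀ y ∈ L, ∃ s, s * x = y := fun x hx y hy => by
    obtain ⟨s, -, h⟩ := hmin x hx y hy
    exact ⟨s, h⟩
  have hinj := injLemma hl hr D hD hinv L hLc hL hmin'
  obtain ⟨e, he, hee⟩ := exists_idempotent_in_compact_subsemigroup hr L hne hLc.isCompact
    (fun x _ y hy => hL x y hy)
  have hel : ∀ x ∈ L, e * x = x := fun x hx =>
    hinj e _ _ (hL e x hx) hx (by rw [← mul_assoc, hee])
  have her : ∀ x ∈ L, x * e = x := by
    intro x hx
    obtain ⟨s, -, rfl⟩ := hmin e he x hx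
    rw [mul_assoc, hee]
  have hgrp : ∀ x ∈ L, ∃ y ∈ L, x * y = e ∧ y * x = e := by
    intro x hx
    obtain ⟨y, hy, hyx⟩ := hmin x hx e he
    obtain ⟨w, hw, hwy⟩ := hmin y hy e he
    refine ⟨y, hy, ?_, hyx⟩
    have : w = x := by
      calc w = w * (y * x) := by rw [hyx, her w hw]
        _ = x := by rw [← mul_assoc, hwy, hel x hx]
    rw [← this, hwy]
  -- right ideal
  have hR : ∀ s, e * s ∈ L := by
    intro s
    have hinjR := injLemma (S := Sᵐᵒᵖ)
      (fun a => MulOpposite.continuous_op.comp ((hr a.unop).comp MulOpposite.continuous_unop))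
      (fun a => MulOpposite.continuous_op.comp ((hl a.unop).comp MulOpposite.continuous_unop))
      (MulOpposite.unop ⁻¹' D)
      (hD.preimage MulOpposite.opHomeomorph.symm.isOpenMap)
      (by
        intro d hd
        obtain ⟨d', hd'⟩ := hinv' _ hd
        exact ⟨MulOpposite.op d', fun x => MulOpposite.unop_injective (hd' x.unop)⟩)
      (MulOpposite.unop ⁻¹' (range fun s => e * s))
      ((isCompact_range (hl e)).isClosed.preimage MulOpposite.continuous_unop)
      (by
        rintro t x ⟨u, hu⟩
        exact ⟨u * t.unop, by simp [← mul_assoc] at hu ⊢; rw [hu]⟩)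
      (by
        rintro x ⟨u, hu⟩ y ⟨v, hv⟩
        obtain ⟨g, hg, hg1, hg2⟩ := hgrp (e * u * e) (hL _ _ he)
        refine ⟨MulOpposite.op (e * g * v), MulOpposite.unop_injective ?_⟩
        simp only at hu hv
        rw [MulOpposite.unop_mul, MulOpposite.unop_op, ← hu, ← hv]
        calc e * u * (e * g * v) = (e * u * e * g) * v := by simp only [mul_assoc]
          _ = e * v := by rw [hg1])
      (MulOpposite.op e) (MulOpposite.op (e * s * e)) (MulOpposite.op (e * s))
      ⟨s * e, by simp [mul_assoc]⟩ ⟨s, rfl⟩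
      (MulOpposite.unop_injective (by simp [mul_assoc, hee]))
    have h := MulOpposite.op_injective hinjR
    rw [← h]
    exact hL _ _ he
  refine ⟨L, hLc, fun s x hx => ⟨hL s x hx, ?_⟩,
    jointLemma hl hr D hD hinv L hLc hL hmin', e, he, fun x hx => ⟨hel x hx, her x hx⟩, hgrp⟩
  rw [← her x hx, mul_assoc]
  exact hL _ _ (hR s)
end

theorem troallic_sushkevich_kernel_is_compact_topological_group
    {S : Type*} [Semigroup S] [TopologicalSpace S] [CompactSpace S] [T2Space S] [Nonempty S]
    -- `S` is semitopological: multiplication is separately continuous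
    (hl : ∀ a : S, Continuous fun x => a * x)
    (hr : ∀ a : S, Continuous fun x => x * a)
    -- a dense subsemigroup which is algebraically a group:
    (D : Subsemigroup S) (hdense : Dense (D : Set S))
    (e₀ : S) (he₀ : e₀ ∈ D)
    (hid : ∀ x ∈ D, e₀ * x = x ∧ x * e₀ = x)
    (hinv : ∀ x ∈ D, ∃ y ∈ D, x * y = e₀ ∧ y * x = e₀) :
    -- `S` contains a unique minimal two-sided ideal `K(S)` ...
    (∃! K : Set S, IsMinimalTwoSidedIdeal K) ∧
    -- ... which is a compact topological group:
    ∀ K : Set S, IsMinimalTwoSidedIdeal K →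
      IsCompact K ∧
      -- `K` is closed under multiplication:
      (∀ x ∈ K, ∀ y ∈ K, x * y ∈ K) ∧
      -- multiplication is jointly continuous on `K`:
      Continuous (fun p : K × K => ((p.1 : S) * (p.2 : S))) ∧
      -- `K` has an identity element:
      ∃ e ∈ K, (∀ x ∈ K, e * x = x ∧ x * e = x) ∧
        -- with continuous inversion:
        ∃ inv : K → K, Continuous inv ∧
          ∀ x : K, (x : S) * (inv x : S) = e ∧ (inv x : S) * (x : S) = e := by
  have hidS : ∀ x, e₀ * x = x := fun x =>
    congrFun (Continuous.ext_on hdense (hl e₀) continuous_id fun y hy => (hid y hy).1) x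
  have hidS' : ∀ x, x * e₀ = x := fun x =>
    congrFun (Continuous.ext_on hdense (hr e₀) continuous_id fun y hy => (hid y hy).2) x
  obtain ⟨L, hLc, hL, hjoint, e, he, hee, hgrp⟩ := kernelLemma hl hr (D : Set S) hdense
    (fun d hd => by
      obtain ⟨d', -, -, h⟩ := hinv d hd
      exact ⟨d', fun x => by rw [← mul_assoc, h, hidS]⟩)
    (fun d hd => by
      obtain ⟨d', -, h, -⟩ := hinv d hd
      exact ⟨d', fun x => by rw [mul_assoc, h, hidS']⟩)
  have hsub : ∀ J : Set S, IsTwoSidedIdeal' J → L ⊆ J := by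
    rintro J ⟨⟨j, hj⟩, hJ⟩ x hx
    obtain ⟨y, -, hy, -⟩ := hgrp (e * j) (hL j e he).2
    have h1 : e * j * y ∈ J := (hJ y _ (hJ e j hj).1).2
    rw [hy] at h1
    rw [← (hee x hx).1]
    exact (hJ x e h1).2
  have hLI : IsTwoSidedIdeal' L := ⟨⟨e, he⟩, hL⟩
  have huniq : ∀ K : Set S, IsMinimalTwoSidedIdeal K → K = L := fun K hK =>
    (hK.2 L hLI (hsub K hK.1)).symm
  refine ⟨⟨L, ⟨hLI, fun J hJ hJL => hJL.antisymm (hsub J hJ)⟩, huniq⟩, fun K hK => ?_⟩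
  obtain rfl := huniq K hK
  refine ⟨hLc.isCompact, fun x _ y hy => (hL x y hy).1, hjoint, e, he, hee, ?_⟩
  choose g hg hg1 hg2 using hgrp
  have : CompactSpace K := isCompact_iff_compactSpace.mp hLc.isCompact
  refine ⟨fun x => ⟨g x x.2, hg x x.2⟩, ?_, fun x => ⟨hg1 x x.2, hg2 x x.2⟩⟩
  rw [continuous_iff_isClosed]
  intro C hC
  have hcl : IsClosed (Prod.fst '' ({p : K × K | (p.1 : S) * (p.2 : S) = e} ∩ Prod.snd ⁻¹' C)) :=
    (((isClosed_eq hjoint continuous_const).inter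
      (hC.preimage continuous_snd)).isCompact.image continuous_fst).isClosed
  convert hcl using 1
  ext x
  constructor
  · intro hx
    exact ⟨(x, ⟨g x x.2, hg x x.2⟩), ⟨hg1 x x.2, hx⟩, rfl⟩
  · rintro ⟨⟨a, b⟩, ⟨hab, hb⟩, rfl⟩
    have hab' : (a : S) * b = e := hab
    have : (⟨g a a.2, hg a a.2⟩ : K) = b := by
      apply Subtype.ext
      calc g a a.2 = g a a.2 * (a * b) := by rw [hab', (hee _ (hg a a.2)).2]
        _ = b := by rw [← mul_assoc, hg2, (hee b b.2).1]
    show (⟨g a a.2, hg a a.2⟩ : K) ∈ C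
    rw [this]; exact hb
end

section
/- (Alaoglu–Birkhoff decomposition) Let V be a Banach space and ρ: G → GL(V) a weakly almost periodic representation of a group G. Then V decomposes as a topological direct sum V = V₁ ⊕ V₂ of closed G-invariant linear subspaces, where V₁ = V^G = {v : ρ(g)v = v for all g ∈ G} and V₂ = {v ∈ V : 0 lies in the norm-closed convex hull of ρ(G)v}. -/
section RN
set_option linter.unusedSectionVars false
open Set Filter Topology

variable {E : Type*} [AddCommGroup E] [Module ℝ E] [TopologicalSpace E] [IsTopologicalAddGroup E]
  [ContinuousSMul ℝ E] [LocallyConvexSpace ℝ E] [T2Space E]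

/-- A minimal compact subset on which all functionals attain their maximum. -/
theorem exists_minimal_norming (X : Set E) (hX : IsCompact X) :
    ∃ Y ⊆ X, Minimal (fun Y => Y ∈ {Y : Set E | Y ⊆ X ∧ IsClosed Y ∧
      ∀ f : E →L[ℝ] ℝ, ∀ x ∈ X, ∃ y ∈ Y, f x ≤ f y}) Y := by
  refine zorn_superset_nonempty _ ?_ X ⟨subset_rfl, hX.isClosed, fun f x hx => ⟨x, hx, le_rfl⟩⟩
  intro c hc hchain hne
  refine ⟨⋂₀ c, ⟨?_, ?_, ?_⟩, fun s hs => sInter_subset_of_mem hs⟩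
  · obtain ⟨s, hs⟩ := hne
    exact (sInter_subset_of_mem hs).trans (hc hs).1
  · exact isClosed_sInter fun s hs => (hc hs).2.1
  · intro f x hx
    obtain ⟨x₀, hx₀, hmax⟩ := hX.exists_isMaxOn ⟨x, hx⟩ f.continuous.continuousOn
    have : Nonempty c := hne.to_subtype
    have key : (⋂ s : c, (s : Set E) ∩ {y | f x₀ ≤ f y}).Nonempty := by
      apply IsCompact.nonempty_iInter_of_directed_nonempty_isCompact_isClosed
      · intro s t
        rcases hchain.total s.2 t.2 with h | h
        · exact ⟨s, subset_rfl, inter_subset_inter_left _ h⟩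
        · exact ⟨t, inter_subset_inter_left _ h, subset_rfl⟩
      · intro s
        obtain ⟨y, hy, h⟩ := (hc s.2).2.2 f x₀ hx₀
        exact ⟨y, hy, h⟩
      · intro s
        exact (hX.of_isClosed_subset (hc s.2).2.1 (hc s.2).1).inter_right
          (isClosed_le continuous_const f.continuous)
      · intro s
        exact (hc s.2).2.1.inter (isClosed_le continuous_const f.continuous)
    obtain ⟨y, hy⟩ := key
    rw [mem_iInter] at hy
    refine ⟨y, fun s hs => (hy ⟨s, hs⟩).1, ?_⟩
    obtain ⟨s, hs⟩ := hne
    exact (hmax hx).trans (hy ⟨s, hs⟩).2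

/-- Small slices. -/
theorem exists_slice (p : Seminorm ℝ E) (hcl : ∀ r, IsClosed {x | p x ≤ r})
    (X : Set E) (hX : IsCompact X) (hne : X.Nonempty)
    (hsep : ∀ ε > 0, ∃ D : Set E, D.Countable ∧ ∀ x ∈ X, ∃ d ∈ D, p (x - d) ≤ ε)
    (R : ℝ) (hR : ∀ x ∈ X, p x ≤ R) (ε : ℝ) (hε : 0 < ε) :
    ∃ f : E →L[ℝ] ℝ, ∃ m c : ℝ, c < m ∧ (∀ x ∈ X, f x ≤ m) ∧ (∃ x ∈ X, f x = m) ∧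
      ∀ y ∈ X, ∀ z ∈ X, c < f y → c < f z → p (y - z) ≤ ε := by
  obtain ⟨Y, hYX, hYmin⟩ := exists_minimal_norming X hX
  obtain ⟨-, hYcl, hYn⟩ := hYmin.prop
  have hYc : IsCompact Y := hX.of_isClosed_subset hYcl hYX
  have hYne : Y.Nonempty := by
    obtain ⟨x, hx⟩ := hne
    obtain ⟨y, hy, -⟩ := hYn 0 x hx
    exact ⟨y, hy⟩
  obtain ⟨D, hDc, hD⟩ := hsep (ε / 4) (by positivity)
  have hlsc : LowerSemicontinuous p := lowerSemicontinuous_iff_isClosed_preimage.2 hcl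
  have hcld (d : E) (r : ℝ) : IsClosed {x | p (x - d) ≤ r} :=
    (hcl r).preimage (continuous_id.sub continuous_const)
  -- Baire
  have : CompactSpace Y := isCompact_iff_compactSpace.1 hYc
  have : Nonempty Y := hYne.to_subtype
  have : Countable D := hDc.to_subtype
  obtain ⟨d, hd⟩ : ∃ d : D, (interior {y : Y | p (y - d) ≤ ε / 4}).Nonempty := by
    apply nonempty_interior_of_iUnion_of_closed
    · intro d
      exact (hcld d (ε / 4)).preimage continuous_subtype_val
    · rw [eq_univ_iff_forall]
      intro y
      obtain ⟨d, hd, h⟩ := hD y (hYX y.2)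
      exact mem_iUnion.2 ⟨⟨d, hd⟩, h⟩
  obtain ⟨W, hWo, hW⟩ := isOpen_induced_iff.1 (isOpen_interior (s := {y : Y | p (y - d) ≤ ε / 4}))
  have hWsub : ∀ y ∈ Y, y ∈ W → p (y - d) ≤ ε / 4 := by
    intro y hy hyW
    have : (⟨y, hy⟩ : Y) ∈ Subtype.val ⁻¹' W := hyW
    rw [hW] at this
    exact (interior_subset this : (⟨y, hy⟩ : Y) ∈ {y : Y | p (y - d) ≤ ε / 4})
  have hnot : ¬ ∀ f : E →L[ℝ] ℝ, ∀ x ∈ X, ∃ y ∈ Y \ W, f x ≤ f y := by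
    intro h
    have := hYmin.le_of_le (y := Y \ W)
      ⟨sdiff_subset.trans hYX, hYcl.sdiff hWo, h⟩ sdiff_subset
    obtain ⟨y, hy⟩ := hd
    rw [← hW] at hy
    exact (this y.2).2 hy
  push Not at hnot
  obtain ⟨f, x₁, hx₁, hf⟩ := hnot
  obtain ⟨x₀, hx₀, hmax⟩ := hX.exists_isMaxOn hne f.continuous.continuousOn
  have hmax' : ∀ x ∈ X, f x ≤ f x₀ := fun x hx => hmax hx
  obtain ⟨m₁, hm₁, hm₁'⟩ : ∃ m₁ < f x₀, ∀ y ∈ Y \ W, f y ≤ m₁ := by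
    rcases (Y \ W).eq_empty_or_nonempty with h | h
    · exact ⟨f x₀ - 1, by linarith, by simp [h]⟩
    · obtain ⟨y₀, hy₀, hm⟩ := (hYc.diff hWo).exists_isMaxOn h f.continuous.continuousOn
      exact ⟨f y₀, (hf y₀ hy₀).trans_le (hmax' _ hx₁), fun y hy => hm hy⟩
  have hR0 : 0 ≤ R := (apply_nonneg p x₀).trans (hR x₀ hx₀)
  set R' := R + p d + 1 with hR'
  have hR'0 : 0 < R' := by have := apply_nonneg p (d : E); linarith
  set L := R' / (f x₀ - m₁) with hL
  have hL0 : 0 < L := div_pos hR'0 (by linarith)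
  let C : Set E := {y | p (y - d) + L * f y ≤ ε / 4 + L * f x₀}
  have hCcl : IsClosed C := by
    have h1 : LowerSemicontinuous fun y => p (y - d) :=
      hlsc.comp (continuous_id.sub continuous_const)
    have h2 : LowerSemicontinuous fun y => L * f y :=
      (continuous_const.mul f.continuous).lowerSemicontinuous
    exact (h1.add h2).isClosed_preimage _
  have hCconv : Convex ℝ C := by
    intro y hy z hz a b ha hb hab
    simp only [C, mem_ofPred_eq] at hy hz ⊢
    have e1 : a • y + b • z - (d : E) = a • (y - d) + b • (z - d) := by
      have : (d : E) = a • (d : E) + b • (d : E) := by rw [← add_smul, hab, one_smul]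
      conv_lhs => rw [this]
      module
    have e2 : p (a • y + b • z - d) ≤ a * p (y - d) + b * p (z - d) := by
      rw [e1]
      refine (map_add_le_add p _ _).trans ?_
      rw [map_smul_eq_mul, map_smul_eq_mul, Real.norm_of_nonneg ha, Real.norm_of_nonneg hb]
    rw [map_add, map_smul, map_smul, smul_eq_mul, smul_eq_mul]
    have h3 : ε / 4 + L * f x₀ = a * (ε / 4 + L * f x₀) + b * (ε / 4 + L * f x₀) := by
      rw [← add_mul, hab, one_mul]
    rw [h3]
    nlinarith [mul_le_mul_of_nonneg_left hy ha, mul_le_mul_of_nonneg_left hz hb]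
  have hYC : Y ⊆ C := by
    intro y hy
    simp only [C, mem_ofPred_eq]
    by_cases hyW : y ∈ W
    · have := hWsub y hy hyW
      have := mul_le_mul_of_nonneg_left (hmax' y (hYX hy)) hL0.le
      linarith
    · have h1 := hm₁' y ⟨hy, hyW⟩
      have h2 : p (y - d) ≤ R' := by
        have := map_sub_le_add p y (d : E)
        have := hR y (hYX hy)
        linarith
      have h3 : L * (f x₀ - m₁) = R' := div_mul_cancel₀ _ (by linarith)
      have := mul_le_mul_of_nonneg_left h1 hL0.le
      linarith
  have hXC : X ⊆ C := by
    intro x hx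
    by_contra hxC
    obtain ⟨g, u, hg, hu⟩ := geometric_hahn_banach_closed_point hCconv hCcl hxC
    obtain ⟨y, hy, hxy⟩ := hYn g x hx
    have := hg y (hYC hy)
    linarith
  have hfin : ∀ y ∈ X, f x₀ - ε / 4 / L < f y → p (y - d) ≤ ε / 2 := by
    intro y hy h
    have h1 : p (y - d) + L * f y ≤ ε / 4 + L * f x₀ := hXC hy
    have h2 : L * (ε / 4 / L) = ε / 4 := by field_simp
    have := mul_lt_mul_of_pos_left h hL0
    linarith
  refine ⟨f, f x₀, f x₀ - ε / 4 / L, by have : 0 < ε / 4 / L := by positivity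
                                        linarith, hmax', ⟨x₀, hx₀, rfl⟩, ?_⟩
  intro y hy z hz hcy hcz
  have e : y - z = (y - d) - (z - d) := by abel
  rw [e]
  refine (map_sub_le_add p _ _).trans ?_
  linarith [hfin y hy hcy, hfin z hz hcz]

/-- Markov–Kakutani for a single map. -/
theorem exists_fixed_single (T : E →L[ℝ] E) (K : Set E) (hK : IsCompact K) (hconv : Convex ℝ K)
    (hne : K.Nonempty) (hT : ∀ x ∈ K, T x ∈ K) : ∃ x ∈ K, T x = x := by
  by_contra hcon
  push Not at hcon
  let S : E →L[ℝ] E := T - ContinuousLinearMap.id ℝ E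
  have h0 : (0 : E) ∉ S '' K := by
    rintro ⟨x, hx, h⟩
    exact hcon x hx (sub_eq_zero.1 h)
  obtain ⟨f, u, hu, hf⟩ := geometric_hahn_banach_point_closed
    (hconv.linear_image S.toLinearMap) (hK.image S.continuous).isClosed h0
  rw [map_zero] at hu
  obtain ⟨x, hx⟩ := hne
  obtain ⟨x₀, hx₀, hmax⟩ := hK.exists_isMaxOn ⟨x, hx⟩ f.continuous.continuousOn
  have hit : ∀ n : ℕ, ∃ y ∈ K, f x + n * u ≤ f y := by
    intro n
    induction n with
    | zero => exact ⟨x, hx, by simp⟩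
    | succ n ih =>
      obtain ⟨y, hy, h⟩ := ih
      refine ⟨T y, hT y hy, ?_⟩
      have := hf (S y) ⟨y, hy, rfl⟩
      have e : f (S y) = f (T y) - f y := by simp [S]
      push_cast
      linarith
  obtain ⟨n, hn⟩ := exists_nat_gt ((f x₀ - f x) / u)
  obtain ⟨y, hy, h⟩ := hit n
  have h1 : f y ≤ f x₀ := hmax hy
  rw [div_lt_iff₀ hu] at hn
  linarith

/-- A Ryll-Nardzewski type theorem, invariant seminorm version. -/
theorem ryll_nardzewski_inv {G : Type*} [Group G] (A : G →* (E →L[ℝ] E))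
    (p : Seminorm ℝ E) (hcl : ∀ r, IsClosed {x | p x ≤ r})
    (hinv : ∀ g x, p (A g x) = p x)
    (K : Set E) (hK : IsCompact K) (hconv : Convex ℝ K) (hne : K.Nonempty)
    (hA : ∀ g, ∀ x ∈ K, A g x ∈ K)
    (hsep : ∀ ε > 0, ∃ D : Set E, D.Countable ∧ ∀ x ∈ K, ∃ d ∈ D, p (x - d) ≤ ε)
    (R : ℝ) (hR : ∀ x ∈ K, p x ≤ R) :
    ∃ x ∈ K, ∀ g, p (A g x - x) = 0 := by
  classical
  have main : (K ∩ ⋂ g : G, {x | p (A g x - x) ≤ 0}).Nonempty := by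
    apply hK.inter_iInter_nonempty
    · intro g
      exact (hcl 0).preimage ((A g).continuous.sub continuous_id)
    intro F
    rcases F.eq_empty_or_nonempty with rfl | hF
    · simpa using hne
    have hcard : (0 : ℝ) < F.card := by exact_mod_cast hF.card_pos
    let T : E →L[ℝ] E := ∑ g ∈ F, (F.card : ℝ)⁻¹ • A g
    have hTx : ∀ x, T x = ∑ g ∈ F, (F.card : ℝ)⁻¹ • A g x := by
      intro x; simp [T]
    obtain ⟨x, hx, hfix⟩ := exists_fixed_single T K hK hconv hne (by
      intro x hx
      rw [hTx]
      refine hconv.sum_mem (fun _ _ => by positivity) ?_ fun g _ => hA g x hx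
      simp [hcard.ne'])
    refine ⟨x, hx, ?_⟩
    simp only [mem_iInter, mem_ofPred_eq]
    intro g hg
    by_contra hpos
    push Not at hpos
    set O : Set E := range fun h => A h x
    have hOK : closure O ⊆ K :=
      closure_minimal (by rintro _ ⟨h, rfl⟩; exact hA h x hx) hK.isClosed
    obtain ⟨f, m, c, hcm, hfm, ⟨x₀, hx₀, hx₀m⟩, hsl⟩ := exists_slice p hcl (closure O)
      (hK.of_isClosed_subset isClosed_closure hOK) ⟨_, subset_closure ⟨1, rfl⟩⟩
      (fun ε hε => by
        obtain ⟨D, hD, h⟩ := hsep ε hε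
        exact ⟨D, hD, fun x hx => h x (hOK hx)⟩) R (fun x hx => hR x (hOK hx))
      (p (A g x - x) / 2) (by positivity)
    -- an orbit point deep in the slice
    obtain ⟨y, hyf, ⟨h, rfl⟩⟩ := mem_closure_iff.1 hx₀ {y | m - (m - c) / F.card < f y}
      (isOpen_lt continuous_const f.continuous) (by
        have : 0 < (m - c) / F.card := div_pos (by linarith) hcard
        simp only [mem_ofPred_eq]; linarith)
    simp only [mem_ofPred_eq] at hyf
    have hmem : ∀ k, A k x ∈ closure O := fun k => subset_closure ⟨k, rfl⟩
    have e1 : f (A h x) = ∑ k ∈ F, (F.card : ℝ)⁻¹ * f (A (h * k) x) := by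
      conv_lhs => rw [← hfix, hTx]
      simp [map_sum]
    have e2 : c < f (A (h * g) x) := by
      have h1 : ∑ k ∈ F, f (A (h * k) x) = F.card * f (A h x) := by
        rw [e1, ← Finset.mul_sum]; field_simp
      have h2 : ∑ k ∈ F, f (A (h * k) x) ≤ f (A (h * g) x) + (F.card - 1) * m := by
        rw [← Finset.add_sum_erase _ _ hg]
        have := Finset.sum_le_card_nsmul (F.erase g) (fun k => f (A (h * k) x)) m
          (fun k _ => hfm _ (hmem _))
        rw [Finset.card_erase_of_mem hg, nsmul_eq_mul, Nat.cast_sub hF.card_pos] at this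
        simpa using this
      have h3 : F.card * (m - (m - c) / F.card) < F.card * f (A h x) :=
        mul_lt_mul_of_pos_left hyf hcard
      have h4 : (F.card : ℝ) * (m - (m - c) / F.card) = F.card * m - (m - c) := by
        field_simp
      linarith
    have e3 : c < f (A h x) := by
      refine lt_of_le_of_lt ?_ hyf
      have : (m - c) / F.card ≤ m - c := by
        apply div_le_self (by linarith)
        exact_mod_cast hF.card_pos
      linarith
    have := hsl _ (hmem (h * g)) _ (hmem h) e2 e3
    have e4 : A (h * g) x - A h x = A h (A g x - x) := by simp
    rw [e4, hinv] at this
    linarith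
  obtain ⟨x, hx, h⟩ := main
  rw [mem_iInter] at h
  exact ⟨x, hx, fun g => le_antisymm (h g) (apply_nonneg _ _)⟩

/-- A Ryll-Nardzewski type theorem. -/
theorem ryll_nardzewski {G : Type*} [Group G] (A : G →* (E →L[ℝ] E))
    (q : Seminorm ℝ E) (hcl : ∀ r, IsClosed {x | q x ≤ r})
    (hbdd : ∀ x, BddAbove (range fun g => q (A g x)))
    (K : Set E) (hK : IsCompact K) (hconv : Convex ℝ K) (hne : K.Nonempty)
    (hA : ∀ g, ∀ x ∈ K, A g x ∈ K)
    (hsep : ∀ ε > 0, ∃ D : Set E, D.Countable ∧ ∀ x ∈ K, ∃ d ∈ D, ∀ g, q (A g (x - d)) ≤ ε)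
    (R : ℝ) (hR : ∀ x ∈ K, ∀ g, q (A g x) ≤ R) :
    ∃ x ∈ K, ∀ g, q (A g x - x) = 0 := by
  have hb : BddAbove (range fun g => q.comp (A g).toLinearMap) :=
    Seminorm.bddAbove_range_iff.2 hbdd
  let p : Seminorm ℝ E := ⨆ g, q.comp (A g).toLinearMap
  have hp : ∀ x, p x = ⨆ g, q (A g x) := fun x => Seminorm.iSup_apply hb
  have hp_le : ∀ x r, p x ≤ r ↔ ∀ g, q (A g x) ≤ r := fun x r => by
    rw [hp]; exact ciSup_le_iff (hbdd x)
  obtain ⟨x, hx, h⟩ := ryll_nardzewski_inv A p (fun r => by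
      have : {x | p x ≤ r} = ⋂ g, (A g) ⁻¹' {x | q x ≤ r} := by
        ext x; simp [hp_le]
      rw [this]
      exact isClosed_iInter fun g => (hcl r).preimage (A g).continuous)
    (fun g x => by
      rw [hp, hp]
      have : ∀ k, q (A k (A g x)) = q (A (k * g) x) := fun k => by simp
      simp only [this]
      exact (Equiv.mulRight g).iSup_comp (g := fun k => q (A k x)))
    K hK hconv hne hA (fun ε hε => by
      obtain ⟨D, hD, h⟩ := hsep ε hε
      refine ⟨D, hD, fun x hx => ?_⟩
      obtain ⟨d, hd, h⟩ := h x hx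
      exact ⟨d, hd, (hp_le _ _).2 h⟩) R (fun x hx => (hp_le _ _).2 (hR x hx))
  refine ⟨x, hx, fun g => le_antisymm ?_ (apply_nonneg _ _)⟩
  simpa using (hp_le _ _).1 (h g).le 1

end RN

section Weak
open Set Filter Topology MeasureTheory

variable {V : Type*} [NormedAddCommGroup V] [NormedSpace ℝ V]

theorem continuous_weak_eval (f : V →L[ℝ] ℝ) :
    Continuous fun x : WeakSpace ℝ V => f ((toWeakSpace ℝ V).symm x) :=
  WeakBilin.eval_continuous _ f

theorem continuous_to_weak {α : Type*} [TopologicalSpace α] {g : α → WeakSpace ℝ V}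
    (h : ∀ f : V →L[ℝ] ℝ, Continuous fun a => f ((toWeakSpace ℝ V).symm (g a))) :
    Continuous g :=
  WeakBilin.continuous_of_continuous_eval _ h

theorem isClosed_weak_of_convex {s : Set V} (hs : Convex ℝ s) (hc : IsClosed s) :
    IsClosed ((toWeakSpace ℝ V) '' s) := by
  have := hs.toWeakSpace_closure ℝ
  rw [hc.closure_eq] at this
  rw [this]
  exact isClosed_closure

theorem isClosed_weak_preimage {s : Set V} (hs : Convex ℝ s) (hc : IsClosed s) :
    IsClosed ((toWeakSpace ℝ V).symm ⁻¹' s) := by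
  have := isClosed_weak_of_convex hs hc
  convert this using 1
  ext x
  constructor
  · intro h
    exact ⟨_, h, (toWeakSpace ℝ V).apply_symm_apply x⟩
  · rintro ⟨y, hy, rfl⟩
    simpa using hy

/-- weakly relatively compact sets are norm bounded -/
theorem bounded_of_weak_compact {s : Set V} (hc : IsCompact (closure ((toWeakSpace ℝ V) '' s))) :
    ∃ C, ∀ x ∈ s, ‖x‖ ≤ C := by
  obtain ⟨C, hC⟩ := banach_steinhaus (𝕜 := ℝ) (𝕜₂ := ℝ)
    (g := fun x : s => NormedSpace.inclusionInDoubleDual ℝ V x) (by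
      intro f
      obtain ⟨C, hC⟩ := (hc.image (continuous_weak_eval f)).isBounded.exists_norm_le
      refine ⟨C, fun x => ?_⟩
      have := hC (f x) ⟨toWeakSpace ℝ V x, subset_closure ⟨x, x.2, rfl⟩, by simp⟩
      simpa using this)
  refine ⟨C, fun x hx => ?_⟩
  have h1 := hC ⟨x, hx⟩
  have h2 := (NormedSpace.inclusionInDoubleDualLi (E := V) ℝ).norm_map x
  have h3 : ‖NormedSpace.inclusionInDoubleDual ℝ V x‖ = ‖x‖ := h2
  rw [← h3]
  exact h1

variable {s : Set V}

theorem isSeparable_hull (hs : s.Countable) :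
    TopologicalSpace.IsSeparable (closure (convexHull ℝ s)) := by
  apply TopologicalSpace.IsSeparable.closure
  apply (hs.isSeparable.span (R := ℝ)).mono
  exact convexHull_min Submodule.subset_span (Submodule.convex _)

theorem weak_closure_subset_hull :
    ∀ x ∈ closure ((toWeakSpace ℝ V) '' s),
      (toWeakSpace ℝ V).symm x ∈ closure (convexHull ℝ s) := by
  have : closure ((toWeakSpace ℝ V) '' s) ⊆
      (toWeakSpace ℝ V).symm ⁻¹' (closure (convexHull ℝ s)) := by
    apply closure_minimal
    · rintro _ ⟨x, hx, rfl⟩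
      simpa using subset_closure (subset_convexHull ℝ s hx)
    · exact isClosed_weak_preimage (convex_convexHull ℝ s).closure isClosed_closure
  exact this

/-- Krein's theorem for countable sets. -/
theorem weak_compact_hull [CompleteSpace V] (hs : s.Countable)
    (hc : IsCompact (closure ((toWeakSpace ℝ V) '' s))) :
    IsCompact ((toWeakSpace ℝ V) '' closure (convexHull ℝ s)) := by
  set X := closure ((toWeakSpace ℝ V) '' s) with hX
  let _ : MeasurableSpace X := borel X
  have : BorelSpace X := ⟨rfl⟩
  let _ : MeasurableSpace V := borel V
  have : BorelSpace V := ⟨rfl⟩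
  have : CompactSpace X := isCompact_iff_compactSpace.1 hc
  obtain ⟨C, hC⟩ := bounded_of_weak_compact hc
  let ι : X → V := fun x => (toWeakSpace ℝ V).symm x.1
  have hιmem : ∀ x, ι x ∈ closure (convexHull ℝ s) := fun x => weak_closure_subset_hull x.1 x.2
  have hιC : ∀ x, ‖ι x‖ ≤ C := by
    intro x
    have : closure (convexHull ℝ s) ⊆ Metric.closedBall 0 C := by
      apply closure_minimal _ Metric.isClosed_closedBall
      exact convexHull_min (fun x hx => by simpa using hC x hx) (convex_closedBall _ _)
    simpa using this (hιmem x)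
  have hsep := isSeparable_hull hs
  have hιcont : ∀ f : V →L[ℝ] ℝ, Continuous fun x => f (ι x) := fun f =>
    (continuous_weak_eval f).comp continuous_subtype_val
  have hmeas : Measurable ι := by
    apply measurable_of_isOpen
    intro U hU
    obtain ⟨D, hD, hDd⟩ := hsep
    have : ι ⁻¹' U = ⋃ d ∈ D, ⋃ n : ℕ, ⋃ (_ : Metric.closedBall d (1 / (n + 1 : ℝ)) ⊆ U),
        ι ⁻¹' (Metric.closedBall d (1 / (n + 1 : ℝ))) := by
      ext x
      simp only [mem_preimage, mem_iUnion]
      constructor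
      · intro hx
        obtain ⟨ε, hε, hεU⟩ := Metric.isOpen_iff.1 hU _ hx
        obtain ⟨n, hn⟩ := exists_nat_one_div_lt (half_pos hε)
        obtain ⟨d, hd, hxd⟩ := Metric.mem_closure_iff.1 (hDd (hιmem x)) (1 / (n + 1 : ℝ))
          (by positivity)
        refine ⟨d, hd, n, fun y hy => hεU ?_, ?_⟩
        · rw [Metric.mem_ball]
          rw [Metric.mem_closedBall] at hy
          have := dist_triangle_right y (ι x) d
          linarith
        · exact hxd.le
      · rintro ⟨d, hd, n, h, hx⟩
        exact h hx
    rw [this]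
    refine MeasurableSet.biUnion hD fun d hd => MeasurableSet.iUnion fun n =>
      MeasurableSet.iUnion fun _ => ?_
    apply IsClosed.measurableSet
    exact (isClosed_weak_preimage (convex_closedBall _ _) Metric.isClosed_closedBall).preimage
      continuous_subtype_val
  have hsm : StronglyMeasurable ι := stronglyMeasurable_iff_measurable_separable.2
    ⟨hmeas, hsep.mono (by rintro _ ⟨x, rfl⟩; exact hιmem x)⟩
  have hIntgr : ∀ μ : Measure X, IsFiniteMeasure μ → Integrable ι μ := fun μ _ =>
    Integrable.of_bound hsm.aestronglyMeasurable C (Eventually.of_forall hιC)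
  let b : ProbabilityMeasure X → WeakSpace ℝ V := fun μ => toWeakSpace ℝ V (∫ x, ι x ∂(μ : Measure X))
  have hb : Continuous b := by
    apply continuous_to_weak
    intro f
    have : ∀ μ : ProbabilityMeasure X, f ((toWeakSpace ℝ V).symm (b μ)) =
        ∫ x, BoundedContinuousFunction.mkOfCompact ⟨_, hιcont f⟩ x ∂(μ : Measure X) := by
      intro μ
      have h := f.integral_comp_comm (hIntgr μ inferInstance)
      simpa [b] using h.symm
    simp only [this]
    rw [continuous_iff_continuousAt]
    intro μ
    exact ProbabilityMeasure.tendsto_iff_forall_integral_tendsto.1 tendsto_id _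
  have hcomp : IsCompact (range b) := isCompact_range hb
  have hconv : Convex ℝ (range b) := by
    rintro _ ⟨μ, rfl⟩ _ ⟨ν, rfl⟩ a c ha hc hac
    let π : Measure X := ENNReal.ofReal a • (μ : Measure X) + ENNReal.ofReal c • (ν : Measure X)
    have : IsProbabilityMeasure π := ⟨by
      simp only [π, Measure.add_apply, Measure.smul_apply, measure_univ, smul_eq_mul, mul_one]
      rw [← ENNReal.ofReal_add ha hc, hac, ENNReal.ofReal_one]⟩
    refine ⟨⟨π, this⟩, ?_⟩
    have : ∫ x, ι x ∂π = a • ∫ x, ι x ∂(μ : Measure X) + c • ∫ x, ι x ∂(ν : Measure X) := by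
      rw [integral_add_measure ((hIntgr μ inferInstance).smul_measure ENNReal.ofReal_ne_top)
        ((hIntgr ν inferInstance).smul_measure ENNReal.ofReal_ne_top), integral_smul_measure,
        integral_smul_measure, ENNReal.toReal_ofReal ha, ENNReal.toReal_ofReal hc]
    simp only [b, ProbabilityMeasure.coe_mk, this, map_add, map_smul]
  have hsub : (toWeakSpace ℝ V) '' s ⊆ range b := by
    rintro _ ⟨x, hx, rfl⟩
    let x' : X := ⟨toWeakSpace ℝ V x, subset_closure ⟨x, hx, rfl⟩⟩
    refine ⟨⟨Measure.dirac x', inferInstance⟩, ?_⟩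
    simp only [b, ProbabilityMeasure.coe_mk]
    rw [integral_dirac' _ _ hsm]
    simp [ι, x']
  rw [(convex_convexHull ℝ s).toWeakSpace_closure ℝ]
  refine hcomp.of_isClosed_subset isClosed_closure (closure_minimal ?_ hcomp.isClosed)
  have : (toWeakSpace ℝ V) '' (convexHull ℝ s) = convexHull ℝ ((toWeakSpace ℝ V) '' s) :=
    LinearMap.image_convexHull (toWeakSpace ℝ V).toLinearMap s
  rw [this]
  exact convexHull_min hsub hconv

/-- Uniform separability of functionals on a countable weakly relatively compact set. -/
theorem dual_separable (hs : s.Countable)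
    (hc : IsCompact (closure ((toWeakSpace ℝ V) '' s))) (ε : ℝ) (hε : 0 < ε) :
    ∃ D : Set (V →L[ℝ] ℝ), D.Countable ∧ ∀ f : V →L[ℝ] ℝ, ∃ d ∈ D, ∀ x ∈ s, |f x - d x| ≤ ε := by
  set X := closure ((toWeakSpace ℝ V) '' s) with hX
  have : CompactSpace X := isCompact_iff_compactSpace.1 hc
  let ι : X → V := fun x => (toWeakSpace ℝ V).symm x.1
  have hιcont : ∀ f : V →L[ℝ] ℝ, Continuous fun x => f (ι x) := fun f =>
    (continuous_weak_eval f).comp continuous_subtype_val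
  have hιinj : Function.Injective ι := fun x y h =>
    Subtype.ext ((toWeakSpace ℝ V).symm.injective h)
  obtain ⟨D, hD, hDd⟩ : TopologicalSpace.IsSeparable
      (closure (Submodule.span ℝ s : Set V)) := (hs.isSeparable.span (R := ℝ)).closure
  have hιmem : ∀ x, ι x ∈ (Submodule.span ℝ s).topologicalClosure := fun x => by
    have h := weak_closure_subset_hull x.1 x.2
    exact closure_mono (convexHull_min Submodule.subset_span (Submodule.convex _)) h
  choose F hF1 hF2 using fun d : V => exists_dual_vector'' ℝ d
  have : Countable D := hD.to_subtype
  let φ : X → (D → ℝ) := fun x d => F d (ι x)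
  have hφc : Continuous φ := continuous_pi fun d => hιcont _
  have hφi : Function.Injective φ := by
    intro x y hxy
    by_contra hne
    have hpos : 0 < ‖ι x - ι y‖ := norm_pos_iff.2 (sub_ne_zero.2 fun h => hne (hιinj h))
    obtain ⟨d, hd, hxd⟩ := Metric.mem_closure_iff.1
      (hDd (Submodule.sub_mem _ (hιmem x) (hιmem y))) (‖ι x - ι y‖ / 2) (by positivity)
    rw [dist_eq_norm] at hxd
    have h1 : F d (ι x - ι y) = 0 := by
      have := congrFun hxy ⟨d, hd⟩
      rw [map_sub, sub_eq_zero]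
      exact this
    have h2 : F d (ι x - ι y - d) = -‖d‖ := by
      rw [map_sub, h1, hF2]; simp
    have h3 : ‖d‖ ≤ ‖ι x - ι y - d‖ := by
      have := (F d).le_of_opNorm_le (hF1 d) (ι x - ι y - d)
      rw [h2, norm_neg, Real.norm_of_nonneg (norm_nonneg _), one_mul] at this
      exact this
    have h4 : ‖ι x - ι y‖ ≤ ‖ι x - ι y - d‖ + ‖d‖ := by
      simpa using norm_add_le (ι x - ι y - d) d
    linarith
  have : SecondCountableTopology X := (hφc.isClosedEmbedding hφi).isEmbedding.secondCountableTopology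
  let Φ : (V →L[ℝ] ℝ) → C(X, ℝ) := fun f => ⟨_, hιcont f⟩
  obtain ⟨T, hT, hTc, hTd⟩ := (TopologicalSpace.IsSeparable.of_separableSpace
    (range Φ)).exists_countable_dense_subset
  choose! g hg using fun t (ht : t ∈ T) => hT ht
  refine ⟨g '' T, hTc.image _, fun f => ?_⟩
  obtain ⟨t, ht, hft⟩ := Metric.mem_closure_iff.1 (hTd (mem_range_self f)) ε hε
  refine ⟨g t, mem_image_of_mem _ ht, fun x hx => ?_⟩
  let x' : X := ⟨toWeakSpace ℝ V x, subset_closure ⟨x, hx, rfl⟩⟩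
  have h1 := ContinuousMap.dist_apply_le_dist (f := Φ f) (g := t) x'
  have h2 : Φ f x' = f x := by simp [Φ, ι, x']
  have h3 : t x' = g t x := by
    have h4 : Φ (g t) x' = g t x := by simp [Φ, ι, x']
    rwa [hg t ht] at h4
  rw [h2, h3, Real.dist_eq] at h1
  exact h1.trans hft.le

end Weak

section Rep
open Set Filter Topology
set_option linter.unusedSectionVars false

theorem hull_mapsTo {E F : Type*} [AddCommGroup E] [Module ℝ E] [TopologicalSpace E]
    [IsTopologicalAddGroup E] [ContinuousSMul ℝ E]
    [AddCommGroup F] [Module ℝ F] [TopologicalSpace F]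
    [IsTopologicalAddGroup F] [ContinuousSMul ℝ F]
    (T : E →L[ℝ] F) (s : Set E) (t : Set F) (ht : Convex ℝ t) (htc : IsClosed t)
    (h : ∀ x ∈ s, T x ∈ t) :
    ∀ x ∈ closure (convexHull ℝ s), T x ∈ t := by
  have : closure (convexHull ℝ s) ⊆ T ⁻¹' t := by
    apply closure_minimal _ (htc.preimage T.continuous)
    exact convexHull_min h (ht.linear_preimage T.toLinearMap)
  exact this

variable {G : Type*} [Group G] {V : Type*} [NormedAddCommGroup V] [NormedSpace ℝ V]
  [CompleteSpace V]

theorem rho_one (ρ : G →* (V ≃L[ℝ] V)) (v : V) : ρ 1 v = v := by rw [map_one]; rfl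

theorem rho_mul (ρ : G →* (V ≃L[ℝ] V)) (g h : G) (v : V) : ρ (g * h) v = ρ g (ρ h v) := by
  rw [map_mul]; rfl

instance weakSpace_lcs : LocallyConvexSpace ℝ (WeakSpace ℝ V) :=
  WeakBilin.locallyConvexSpace (B := (topDualPairing ℝ V).flip)

instance weakDual_lcs : LocallyConvexSpace ℝ (WeakDual ℝ V) :=
  WeakBilin.locallyConvexSpace (B := topDualPairing ℝ V)

/-- closed convex hull of the orbit -/
def orbHull (ρ : G →* (V ≃L[ℝ] V)) (v : V) : Set V :=
  closure (convexHull ℝ (Set.range fun g => ρ g v))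

theorem orbHull_convex (ρ : G →* (V ≃L[ℝ] V)) (v : V) : Convex ℝ (orbHull ρ v) :=
  (convex_convexHull ℝ _).closure

theorem orbHull_closed (ρ : G →* (V ≃L[ℝ] V)) (v : V) : IsClosed (orbHull ρ v) :=
  isClosed_closure

theorem orb_mem (ρ : G →* (V ≃L[ℝ] V)) (v : V) (g : G) : ρ g v ∈ orbHull ρ v :=
  subset_closure (subset_convexHull ℝ _ ⟨g, rfl⟩)

theorem self_mem (ρ : G →* (V ≃L[ℝ] V)) (v : V) : v ∈ orbHull ρ v := by
  have h := orb_mem ρ v 1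
  rwa [rho_one] at h

theorem orbHull_inv (ρ : G →* (V ≃L[ℝ] V)) (v : V) (g : G) :
    ∀ x ∈ orbHull ρ v, ρ g x ∈ orbHull ρ v := by
  refine hull_mapsTo (ρ g : V →L[ℝ] V) _ _ (orbHull_convex ρ v) (orbHull_closed ρ v) ?_
  rintro _ ⟨h, rfl⟩
  have h := orb_mem ρ v (g * h)
  rwa [rho_mul] at h

theorem orbHull_subset (ρ : G →* (V ≃L[ℝ] V)) {v y : V} (hy : y ∈ orbHull ρ v) :
    orbHull ρ y ⊆ orbHull ρ v := by
  apply closure_minimal _ (orbHull_closed ρ v)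
  apply convexHull_min _ (orbHull_convex ρ v)
  rintro _ ⟨g, rfl⟩
  exact orbHull_inv ρ v g y hy

def Wap (ρ : G →* (V ≃L[ℝ] V)) : Prop :=
  ∀ v : V, IsCompact (closure ((toWeakSpace ℝ V) '' (Set.range fun g => ρ g v)))

theorem Wap.bound {ρ : G →* (V ≃L[ℝ] V)} (h : Wap ρ) :
    ∃ C, 0 ≤ C ∧ ∀ g x, ‖ρ g x‖ ≤ C * ‖x‖ := by
  obtain ⟨C, hC⟩ := banach_steinhaus (𝕜 := ℝ) (𝕜₂ := ℝ)
    (g := fun g : G => (ρ g : V →L[ℝ] V)) (by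
      intro x
      obtain ⟨C, hC⟩ := bounded_of_weak_compact (h x)
      exact ⟨C, fun g => hC _ ⟨g, rfl⟩⟩)
  exact ⟨C, (norm_nonneg _).trans (hC 1), fun g x => (ρ g : V →L[ℝ] V).le_of_opNorm_le (hC g) x⟩

theorem exists_fixed_countable [Countable G] {ρ : G →* (V ≃L[ℝ] V)} (hw : Wap ρ) (v : V) :
    ∃ w ∈ orbHull ρ v, ∀ g, ρ g w = w := by
  obtain ⟨C, hC0, hC⟩ := hw.bound
  have hcount : (range fun g => ρ g v).Countable := countable_range _
  let A : G →* (WeakSpace ℝ V →L[ℝ] WeakSpace ℝ V) :=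
    { toFun := fun g => WeakSpace.map (ρ g : V →L[ℝ] V)
      map_one' := ContinuousLinearMap.ext fun x => rho_one ρ ((toWeakSpace ℝ V).symm x)
      map_mul' := fun g h => ContinuousLinearMap.ext fun x => rho_mul ρ g h ((toWeakSpace ℝ V).symm x) }
  have hAa : ∀ g x, (toWeakSpace ℝ V).symm (A g x) = ρ g ((toWeakSpace ℝ V).symm x) :=
    fun g x => rfl
  let q : Seminorm ℝ (WeakSpace ℝ V) :=
    (normSeminorm ℝ V).comp (toWeakSpace ℝ V).symm.toLinearMap
  have hq : ∀ x, q x = ‖(toWeakSpace ℝ V).symm x‖ := fun x => rfl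
  have hqA : ∀ g x, q (A g x) ≤ C * ‖(toWeakSpace ℝ V).symm x‖ := by
    intro g x
    rw [hq, hAa]
    exact hC _ _
  obtain ⟨B, hB⟩ := bounded_of_weak_compact (hw v)
  have hBK : ∀ x ∈ orbHull ρ v, ‖x‖ ≤ B := by
    have : orbHull ρ v ⊆ Metric.closedBall 0 B := by
      apply closure_minimal _ Metric.isClosed_closedBall
      exact convexHull_min (fun x hx => by simpa using hB x hx) (convex_closedBall _ _)
    intro x hx
    simpa using this hx
  obtain ⟨_, ⟨w, hw, rfl⟩, hfix⟩ := ryll_nardzewski A q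
    (fun r => by
      have := isClosed_weak_preimage (convex_closedBall (0 : V) r) Metric.isClosed_closedBall
      convert this using 1
      ext x; simp [hq])
    (fun x => ⟨C * ‖(toWeakSpace ℝ V).symm x‖, by rintro _ ⟨g, rfl⟩; exact hqA g x⟩)
    ((toWeakSpace ℝ V) '' orbHull ρ v) (weak_compact_hull hcount (hw v))
    ((orbHull_convex ρ v).linear_image (toWeakSpace ℝ V).toLinearMap)
    ⟨_, v, self_mem ρ v, rfl⟩
    (by
      rintro g _ ⟨x, hx, rfl⟩
      exact ⟨_, orbHull_inv ρ v g x hx, rfl⟩)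
    (by
      intro ε hε
      obtain ⟨D, hD, hDd⟩ := isSeparable_hull hcount
      refine ⟨(toWeakSpace ℝ V) '' D, hD.image _, ?_⟩
      rintro _ ⟨x, hx, rfl⟩
      obtain ⟨d, hd, hxd⟩ := Metric.mem_closure_iff.1 (hDd hx) (ε / (C + 1)) (by positivity)
      refine ⟨_, ⟨d, hd, rfl⟩, fun g => (hqA _ _).trans ?_⟩
      rw [dist_eq_norm, lt_div_iff₀ (by positivity)] at hxd
      rw [← map_sub, LinearEquiv.symm_apply_apply]
      nlinarith [norm_nonneg (x - d)])
    (C * B)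
    (by
      rintro _ ⟨x, hx, rfl⟩ g
      refine (hqA _ _).trans ?_
      rw [LinearEquiv.symm_apply_apply]
      exact mul_le_mul_of_nonneg_left (hBK x hx) hC0)
  refine ⟨w, hw, fun g => ?_⟩
  have h := hfix g
  rw [hq, norm_eq_zero, map_sub, hAa, LinearEquiv.symm_apply_apply, sub_eq_zero] at h
  exact h

theorem unique_fixed_countable [Countable G] {ρ : G →* (V ≃L[ℝ] V)} (hw : Wap ρ) (v : V)
    {w w' : V} (hwm : w ∈ orbHull ρ v) (hwf : ∀ g, ρ g w = w)
    (hwm' : w' ∈ orbHull ρ v) (hwf' : ∀ g, ρ g w' = w') : w = w' := by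
  obtain ⟨C, hC0, hC⟩ := hw.bound
  have hcount : (range fun g => ρ g v).Countable := countable_range _
  rw [← sub_eq_zero]
  apply SeparatingDual.eq_zero_of_forall_dual_eq_zero (R := ℝ)
  intro f
  let A₀ : G → (WeakDual ℝ V →L[ℝ] WeakDual ℝ V) := fun g =>
    { toFun := fun μ => StrongDual.toWeakDual
        ((WeakDual.toStrongDual μ).comp (ρ g⁻¹ : V →L[ℝ] V))
      map_add' := fun μ ν => rfl
      map_smul' := fun c μ => rfl
      cont := by
        apply WeakDual.continuous_of_continuous_eval
        intro x
        exact WeakDual.eval_continuous (ρ g⁻¹ x) }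
  have hA₀ : ∀ g μ x, A₀ g μ x = μ (ρ g⁻¹ x) := fun g μ x => rfl
  let A : G →* (WeakDual ℝ V →L[ℝ] WeakDual ℝ V) :=
    { toFun := A₀
      map_one' := by
        refine ContinuousLinearMap.ext fun μ => DFunLike.ext _ _ fun x => ?_
        rw [hA₀, inv_one, rho_one]; rfl
      map_mul' := by
        intro g h
        refine ContinuousLinearMap.ext fun μ => DFunLike.ext _ _ fun x => ?_
        rw [hA₀, mul_inv_rev, rho_mul]; rfl }
  have hA : ∀ g μ x, A g μ x = μ (ρ g⁻¹ x) := fun g μ x => rfl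
  let ev : V → (WeakDual ℝ V →L[ℝ] ℝ) := fun x =>
    { toFun := fun μ => μ x
      map_add' := fun μ ν => rfl
      map_smul' := fun c μ => rfl
      cont := WeakDual.eval_continuous x }
  let q : Seminorm ℝ (WeakDual ℝ V) := (normSeminorm ℝ ℝ).comp (ev v).toLinearMap
  have hq : ∀ μ, q μ = |μ v| := fun μ => rfl
  let f' : WeakDual ℝ V := StrongDual.toWeakDual f
  let O : Set (WeakDual ℝ V) := range fun g => A g f'
  let K : Set (WeakDual ℝ V) := closure (convexHull ℝ O)
  have hbd : ∀ (μ : WeakDual ℝ V) (g : G),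
      |μ (ρ g⁻¹ v)| ≤ ‖WeakDual.toStrongDual μ‖ * (C * ‖v‖) := by
    intro μ g
    refine ((WeakDual.toStrongDual μ).le_opNorm (ρ g⁻¹ v)).trans ?_
    exact mul_le_mul_of_nonneg_left (hC _ _) (norm_nonneg _)
  have hKball : K ⊆ WeakDual.toStrongDual ⁻¹' Metric.closedBall 0 (‖f‖ * C) := by
    apply closure_minimal _ (WeakDual.isClosed_closedBall _ _)
    apply convexHull_min _
      ((convex_closedBall (0 : StrongDual ℝ V) (‖f‖ * C)).linear_preimage
        (WeakDual.toStrongDual (𝕜 := ℝ) (E := V)).toLinearMap)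
    rintro _ ⟨g, rfl⟩
    simp only [mem_preimage, Metric.mem_closedBall, dist_zero_right]
    refine ContinuousLinearMap.opNorm_le_bound _ (by positivity) fun x => ?_
    have h1 := f.le_opNorm (ρ g⁻¹ x)
    have h2 := mul_le_mul_of_nonneg_left (hC g⁻¹ x) (norm_nonneg f)
    rw [mul_assoc]
    exact h1.trans h2
  have hKc : IsCompact K :=
    (WeakDual.isCompact_closedBall 0 (‖f‖ * C)).of_isClosed_subset isClosed_closure hKball
  have hKconv : Convex ℝ K := (convex_convexHull ℝ _).closure
  obtain ⟨μ, hμK, hμ⟩ := ryll_nardzewski A q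
    (fun r => isClosed_le (ev v).continuous.norm continuous_const)
    (fun μ => ⟨‖WeakDual.toStrongDual μ‖ * (C * ‖v‖), by rintro _ ⟨g, rfl⟩; exact hbd μ g⟩)
    K hKc hKconv ⟨_, subset_closure (subset_convexHull ℝ _ ⟨1, rfl⟩)⟩
    (fun g => hull_mapsTo (A g) _ _ hKconv isClosed_closure (by
      rintro _ ⟨h, rfl⟩
      refine subset_closure (subset_convexHull ℝ _ ⟨g * h, ?_⟩)
      simp))
    (by
      intro ε hε
      obtain ⟨D, hD, hDd⟩ := dual_separable hcount (hw v) ε hε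
      refine ⟨StrongDual.toWeakDual '' D, hD.image _, fun μ hμ => ?_⟩
      obtain ⟨d, hd, h⟩ := hDd (WeakDual.toStrongDual μ)
      exact ⟨_, ⟨d, hd, rfl⟩, fun g => h _ ⟨g⁻¹, rfl⟩⟩)
    (‖f‖ * C * (C * ‖v‖))
    (by
      intro μ hμ g
      refine (hbd μ g).trans (mul_le_mul_of_nonneg_right ?_ (by positivity))
      simpa using hKball hμ)
  have hconst : ∀ g, μ (ρ g v) = μ v := by
    intro g
    have := hμ g⁻¹
    rw [hq, abs_eq_zero] at this
    have h2 : A g⁻¹ μ v - μ v = 0 := this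
    rw [hA, inv_inv, sub_eq_zero] at h2
    exact h2
  have hconst' : ∀ x ∈ orbHull ρ v, WeakDual.toStrongDual μ x ∈ ({μ v} : Set ℝ) :=
    hull_mapsTo (WeakDual.toStrongDual μ) _ _ (convex_singleton _) isClosed_singleton
      (by rintro _ ⟨g, rfl⟩; exact hconst g)
  have hfixed : ∀ x, (∀ g, ρ g x = x) → μ x = f x := by
    intro x hx
    have : ∀ ν ∈ K, ev x ν ∈ ({f x} : Set ℝ) :=
      hull_mapsTo (ev x) _ _ (convex_singleton _) isClosed_singleton
        (by
          rintro _ ⟨g, rfl⟩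
          change f (ρ g⁻¹ x) = f x
          rw [hx])
    exact this μ hμK
  have h1 : μ w = μ v := hconst' w hwm
  have h2 : μ w' = μ v := hconst' w' hwm'
  rw [map_sub, ← hfixed w hwf, ← hfixed w' hwf', h1, h2, sub_self]

end Rep

section Gen
open Set Filter Topology
set_option linter.unusedSectionVars false

variable {G : Type*} [Group G] {V : Type*} [NormedAddCommGroup V] [NormedSpace ℝ V]
  [CompleteSpace V]

theorem countable_closure {S : Set G} (hS : S.Countable) : Countable (Subgroup.closure S) := by
  have : Countable S := hS
  have : Countable (FreeGroup S) := by
    unfold FreeGroup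
    exact Quot.mk_surjective.countable
  have h := FreeGroup.range_lift_eq_closure (f := ((↑) : S → G))
  rw [Subtype.range_coe] at h
  rw [← h]
  exact (MonoidHom.rangeRestrict_surjective (FreeGroup.lift ((↑) : S → G))).countable

theorem countable_iSup (K : ℕ → Subgroup G) (hK : ∀ n, Countable (K n)) :
    Countable (⨆ n, K n : Subgroup G) := by
  rw [Subgroup.iSup_eq_closure]
  exact countable_closure (countable_iUnion fun n => hK n)

theorem countable_sup (H K : Subgroup G) (hH : Countable H) (hK : Countable K) :
    Countable (H ⊔ K : Subgroup G) := by
  have : H ⊔ K = Subgroup.closure ((H : Set G) ∪ K) := by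
    rw [Subgroup.closure_union, Subgroup.closure_eq, Subgroup.closure_eq]
  rw [this]
  exact countable_closure (Set.Countable.union hH hK)

/-- convex hull of the orbit under a subgroup -/
def cH (ρ : G →* (V ≃L[ℝ] V)) (H : Subgroup G) (v : V) : Set V :=
  convexHull ℝ ((fun g => ρ g v) '' (H : Set G))

theorem cH_mono (ρ : G →* (V ≃L[ℝ] V)) {H K : Subgroup G} (h : H ≤ K) (v : V) :
    cH ρ H v ⊆ cH ρ K v := convexHull_mono (image_mono h)

/-- restriction to a subgroup -/
def res (ρ : G →* (V ≃L[ℝ] V)) (H : Subgroup G) : H →* (V ≃L[ℝ] V) := ρ.comp H.subtype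

theorem orbHull_res (ρ : G →* (V ≃L[ℝ] V)) (H : Subgroup G) (v : V) :
    orbHull (res ρ H) v = closure (cH ρ H v) := by
  unfold orbHull cH
  congr 2
  ext x
  constructor
  · rintro ⟨g, rfl⟩
    exact ⟨g, g.2, rfl⟩
  · rintro ⟨g, hg, rfl⟩
    exact ⟨⟨g, hg⟩, rfl⟩

theorem orbHull_top (ρ : G →* (V ≃L[ℝ] V)) (v : V) :
    orbHull ρ v = closure (cH ρ ⊤ v) := by
  simp [orbHull, cH, image_univ]

theorem Wap.res {ρ : G →* (V ≃L[ℝ] V)} (h : Wap ρ) (H : Subgroup G) : Wap (res ρ H) := by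
  intro v
  refine (h v).of_isClosed_subset isClosed_closure (closure_mono (image_mono ?_))
  rintro _ ⟨g, rfl⟩
  exact ⟨g, rfl⟩

theorem cH_directed (ρ : G →* (V ≃L[ℝ] V)) {ι : Type*} (K : ι → Subgroup G)
    (hd : Directed (· ≤ ·) K) (L : Subgroup G) (hL : ∀ g ∈ L, ∃ i, g ∈ K i) (v : V) :
    ∀ x ∈ cH ρ L v, ∃ i, x ∈ cH ρ (K i) v := by
  have : cH ρ L v ⊆ ⋃ i, cH ρ (K i) v := by
    apply convexHull_min
    · rintro _ ⟨g, hg, rfl⟩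
      obtain ⟨i, hi⟩ := hL g hg
      exact mem_iUnion.2 ⟨i, subset_convexHull ℝ _ ⟨g, hi, rfl⟩⟩
    · refine Directed.convex_iUnion ?_ fun i => convex_convexHull ℝ _
      intro i j
      obtain ⟨k, h1, h2⟩ := hd i j
      exact ⟨k, cH_mono ρ h1 v, cH_mono ρ h2 v⟩
  intro x hx
  exact mem_iUnion.1 (this hx)

theorem exists_countable (ρ : G →* (V ≃L[ℝ] V)) (v w : V) (hw : w ∈ orbHull ρ v) :
    ∃ H : Subgroup G, Countable H ∧ w ∈ closure (cH ρ H v) := by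
  rw [orbHull_top, mem_closure_iff_seq_limit] at hw
  obtain ⟨u, hu, hlim⟩ := hw
  have h1 : ∀ n, ∃ i : {H : Subgroup G // Countable H}, u n ∈ cH ρ i.1 v := by
    intro n
    refine cH_directed ρ (fun i : {H : Subgroup G // Countable H} => i.1) ?_ ⊤ ?_ v _ (hu n)
    · intro i j
      exact ⟨⟨i.1 ⊔ j.1, countable_sup _ _ i.2 j.2⟩, le_sup_left, le_sup_right⟩
    · intro g _
      exact ⟨⟨Subgroup.closure {g}, countable_closure (countable_singleton g)⟩,
        Subgroup.subset_closure rfl⟩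
  choose i hi using h1
  refine ⟨⨆ n, (i n).1, countable_iSup _ fun n => (i n).2, ?_⟩
  exact mem_closure_of_tendsto hlim
    (Eventually.of_forall fun n => cH_mono ρ (le_iSup (fun n => (i n).1) n) v (hi n))

theorem fixed_unique {ρ : G →* (V ≃L[ℝ] V)} (hw : Wap ρ) (v : V)
    {w w' : V} (hwm : w ∈ orbHull ρ v) (hwf : ∀ g, ρ g w = w)
    (hwm' : w' ∈ orbHull ρ v) (hwf' : ∀ g, ρ g w' = w') : w = w' := by
  obtain ⟨H, hH, h1⟩ := exists_countable ρ v w hwm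
  obtain ⟨K, hK, h2⟩ := exists_countable ρ v w' hwm'
  have : Countable (H ⊔ K : Subgroup G) := countable_sup H K hH hK
  refine unique_fixed_countable (hw.res (H ⊔ K)) v ?_ (fun g => hwf g) ?_ (fun g => hwf' g)
  · rw [orbHull_res]; exact closure_mono (cH_mono ρ le_sup_left v) h1
  · rw [orbHull_res]; exact closure_mono (cH_mono ρ le_sup_right v) h2

theorem fixed_exists {ρ : G →* (V ≃L[ℝ] V)} (hw : Wap ρ) (v : V) :
    ∃ w ∈ orbHull ρ v, ∀ g, ρ g w = w := by
  obtain ⟨C, hC0, hC⟩ := hw.bound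
  have hX : ∀ H : Subgroup G, ∃ x, Countable H →
      x ∈ orbHull (res ρ H) v ∧ ∀ g ∈ H, ρ g x = x := by
    intro H
    by_cases hH : Countable H
    · obtain ⟨w, h1, h2⟩ := exists_fixed_countable (hw.res H) v
      exact ⟨w, fun _ => ⟨h1, fun g hg => h2 ⟨g, hg⟩⟩⟩
    · exact ⟨0, fun h => (hH h).elim⟩
  choose X hXm using hX
  -- key estimate along a monotone sequence
  have key : ∀ K : ℕ → Subgroup G, Monotone K → (∀ n, Countable (K n)) → ∀ δ > 0,
      ∃ n, ∀ k ≥ n, ‖X (K k) - X (⨆ n, K n)‖ ≤ C * δ := by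
    intro K hK hc δ hδ
    set L := ⨆ n, K n with hL
    have hLc : Countable L := countable_iSup K hc
    obtain ⟨hLm, hLf⟩ := hXm L hLc
    rw [orbHull_res] at hLm
    obtain ⟨y, hy, hyd⟩ := Metric.mem_closure_iff.1 hLm δ hδ
    obtain ⟨n, hn⟩ := cH_directed ρ K hK.directed_le L
      (fun g hg => (Subgroup.mem_iSup_of_directed hK.directed_le).1 hg) v y hy
    refine ⟨n, fun k hk => ?_⟩
    have := hc k
    have hyk : y ∈ orbHull (res ρ (K k)) v := by
      rw [orbHull_res]
      exact subset_closure (cH_mono ρ (hK hk) v hn)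
    obtain ⟨z, hz1, hz2⟩ := exists_fixed_countable (hw.res (K k)) y
    have hzX : X (K k) = z := by
      obtain ⟨h1, h2⟩ := hXm (K k) (hc k)
      exact unique_fixed_countable (hw.res (K k)) v h1 (fun g => h2 g g.2)
        (orbHull_subset _ hyk hz1) hz2
    have hball : orbHull (res ρ (K k)) y ⊆ Metric.closedBall (X L) (C * δ) := by
      apply closure_minimal _ Metric.isClosed_closedBall
      apply convexHull_min _ (convex_closedBall _ _)
      rintro _ ⟨g, rfl⟩
      have hg : ρ g.1 (X L) = X L := hLf g.1 (le_iSup K k g.2)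
      change dist (ρ g.1 y) (X L) ≤ C * δ
      rw [dist_eq_norm]
      nth_rewrite 1 [← hg]
      rw [← map_sub]
      refine (hC _ _).trans (mul_le_mul_of_nonneg_left ?_ hC0)
      rw [← dist_eq_norm, dist_comm]
      exact hyd.le
    have := hball hz1
    rwa [← hzX, Metric.mem_closedBall, dist_eq_norm] at this
  have claim : ∀ ε > 0, ∃ H : Subgroup G, Countable H ∧
      ∀ H' : Subgroup G, Countable H' → H ≤ H' → ‖X H' - X H‖ ≤ ε := by
    intro ε hε
    by_contra! hcon
    choose next hn1 hn2 hn3 using hcon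
    let F : {H : Subgroup G // Countable H} → {H : Subgroup G // Countable H} :=
      fun H => ⟨next H.1 H.2, hn1 H.1 H.2⟩
    let S : ℕ → {H : Subgroup G // Countable H} :=
      fun n => F^[n] ⟨⊥, inferInstance⟩
    have hS : ∀ n, S (n + 1) = F (S n) := fun n => Function.iterate_succ_apply' F n _
    obtain ⟨n, hn⟩ := key (fun n => (S n).1) (monotone_nat_of_le_succ fun n => by
        rw [hS]; exact hn2 _ _) (fun n => (S n).2) (ε / (2 * (C + 1))) (by positivity)
    have h1 := hn n le_rfl
    have h2 := hn (n + 1) (Nat.le_succ n)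
    have h3 : ε < ‖X (S (n + 1)).1 - X (S n).1‖ := by
      rw [hS]; exact hn3 _ _
    have h4 := norm_sub_le_norm_sub_add_norm_sub (X (S (n + 1)).1)
      (X (⨆ n, (S n).1)) (X (S n).1)
    rw [norm_sub_rev (X (⨆ n, (S n).1))] at h4
    have h5 : C * (ε / (2 * (C + 1))) ≤ ε / 2 := by
      rw [mul_div_assoc', div_le_div_iff₀ (by positivity) (by positivity)]
      nlinarith
    linarith
  choose! Hs hs1 hs2 using claim
  let L : Subgroup G := ⨆ n : ℕ, Hs (1 / (n + 1 : ℝ))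
  have hLc : Countable L := countable_iSup _ fun n => hs1 _ (by positivity)
  have hLX : ∀ H' : Subgroup G, Countable H' → L ≤ H' → X H' = X L := by
    intro H' hc hle
    rw [← sub_eq_zero, ← norm_le_zero_iff]
    apply le_of_forall_pos_le_add
    intro ε hε
    obtain ⟨n, hn⟩ := exists_nat_one_div_lt (half_pos hε)
    have hle' : Hs (1 / (n + 1 : ℝ)) ≤ L := le_iSup (fun n : ℕ => Hs (1 / (n + 1 : ℝ))) n
    have h1 := hs2 (1 / (n + 1 : ℝ)) (by positivity) H' hc (hle'.trans hle)
    have h2 := hs2 (1 / (n + 1 : ℝ)) (by positivity) L hLc hle'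
    have h4 := norm_sub_le_norm_sub_add_norm_sub (X H') (X (Hs (1 / (n + 1 : ℝ)))) (X L)
    rw [norm_sub_rev (X (Hs (1 / (n + 1 : ℝ))))] at h4
    linarith
  refine ⟨X L, ?_, fun g => ?_⟩
  · have := (hXm L hLc).1
    rw [orbHull_res] at this
    rw [orbHull_top]
    exact closure_mono (cH_mono ρ le_top v) this
  · have hc : Countable (L ⊔ Subgroup.closure {g} : Subgroup G) :=
      countable_sup _ _ hLc (countable_closure (countable_singleton g))
    rw [← hLX _ hc le_sup_left]
    exact (hXm _ hc).2 g
      ((le_sup_right : Subgroup.closure {g} ≤ L ⊔ _) (Subgroup.subset_closure rfl))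

/-- convex combinations of the operators of the representation -/
def opHull (ρ : G →* (V ≃L[ℝ] V)) : Set (V →L[ℝ] V) :=
  convexHull ℝ (Set.range fun g => (ρ g : V →L[ℝ] V))

/-- evaluation as a linear map -/
def evalL (v : V) : (V →L[ℝ] V) →ₗ[ℝ] V where
  toFun S := S v
  map_add' _ _ := rfl
  map_smul' _ _ := rfl

theorem opHull_image (ρ : G →* (V ≃L[ℝ] V)) (v : V) :
    evalL v '' opHull ρ = convexHull ℝ (Set.range fun g => ρ g v) := by
  rw [opHull, LinearMap.image_convexHull, ← range_comp]
  rfl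

theorem opHull_mem (ρ : G →* (V ≃L[ℝ] V)) (v : V) {S : V →L[ℝ] V} (hS : S ∈ opHull ρ) :
    S v ∈ orbHull ρ v := by
  apply subset_closure
  rw [← opHull_image]
  exact ⟨S, hS, rfl⟩

theorem opHull_approx (ρ : G →* (V ≃L[ℝ] V)) (v : V) {w : V} (hw : w ∈ orbHull ρ v)
    {ε : ℝ} (hε : 0 < ε) : ∃ S ∈ opHull ρ, ‖S v - w‖ < ε := by
  obtain ⟨y, hy, hd⟩ := Metric.mem_closure_iff.1 hw ε hε
  rw [← opHull_image] at hy
  obtain ⟨S, hS, rfl⟩ := hy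
  refine ⟨S, hS, ?_⟩
  rw [← dist_eq_norm, dist_comm]
  exact hd

theorem orbHull_bound {ρ : G →* (V ≃L[ℝ] V)} {C : ℝ} (hC : ∀ g x, ‖ρ g x‖ ≤ C * ‖x‖) (v : V) :
    ∀ x ∈ orbHull ρ v, ‖x‖ ≤ C * ‖v‖ := by
  have : orbHull ρ v ⊆ Metric.closedBall 0 (C * ‖v‖) := by
    apply closure_minimal _ Metric.isClosed_closedBall
    apply convexHull_min _ (convex_closedBall _ _)
    rintro _ ⟨g, rfl⟩
    simpa using hC g v
  intro x hx
  simpa using this hx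

theorem orbHull_fixed {ρ : G →* (V ≃L[ℝ] V)} {v : V} (hv : ∀ g, ρ g v = v) :
    ∀ x ∈ orbHull ρ v, x = v := by
  have : orbHull ρ v ⊆ {v} := by
    apply closure_minimal _ isClosed_singleton
    apply convexHull_min _ (convex_singleton _)
    rintro _ ⟨g, rfl⟩
    exact hv g
  exact this

theorem exists_proj {ρ : G →* (V ≃L[ℝ] V)} (hw : Wap ρ) :
    ∃ p : V →L[ℝ] V, ∀ v, p v ∈ orbHull ρ v ∧ ∀ g, ρ g (p v) = p v := by
  obtain ⟨C, hC0, hC⟩ := hw.bound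
  choose P hPm hPf using fixed_exists hw
  have huniq : ∀ v w, w ∈ orbHull ρ v → (∀ g, ρ g w = w) → P v = w :=
    fun v w h1 h2 => fixed_unique hw v (hPm v) (hPf v) h1 h2
  have hsub : ∀ v y, y ∈ orbHull ρ v → P y = P v := fun v y hy =>
    (huniq v (P y) (orbHull_subset ρ hy (hPm y)) (hPf y)).symm
  have hadd : ∀ u v, P (u + v) = P u + P v := by
    intro u v
    apply huniq
    · rw [← (orbHull_closed ρ (u + v)).closure_eq, Metric.mem_closure_iff]
      intro ε hε
      obtain ⟨S, hS, hSu⟩ := opHull_approx ρ u (hPm u) (ε := ε / (2 * (C + 1))) (by positivity)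
      obtain ⟨T, hT, hTv⟩ := opHull_approx ρ (S v) (hPm (S v)) (half_pos hε)
      rw [hsub v (S v) (opHull_mem ρ v hS)] at hTv
      refine ⟨T (S (u + v)), orbHull_subset ρ (opHull_mem ρ _ hS) (opHull_mem ρ _ hT), ?_⟩
      have h1 : T (P u) = P u := orbHull_fixed (hPf u) _ (opHull_mem ρ _ hT)
      have h2 : ‖T (S u) - P u‖ ≤ C * ‖S u - P u‖ := by
        nth_rewrite 1 [← h1]
        rw [← map_sub]
        exact orbHull_bound hC _ _ (opHull_mem ρ _ hT)
      have h3 : C * ‖S u - P u‖ ≤ ε / 2 := by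
        refine (mul_le_mul_of_nonneg_left hSu.le hC0).trans ?_
        rw [mul_div_assoc', div_le_div_iff₀ (by positivity) (by positivity)]
        nlinarith
      rw [dist_comm, dist_eq_norm, map_add, map_add, add_sub_add_comm]
      exact (norm_add_le _ _).trans_lt (by linarith)
    · intro g
      rw [map_add, hPf, hPf]
  have hsmul : ∀ (c : ℝ) v, P (c • v) = c • P v := by
    intro c v
    apply huniq
    · refine hull_mapsTo (c • ContinuousLinearMap.id ℝ V) _ _ (orbHull_convex ρ _)
        (orbHull_closed ρ _) ?_ (P v) (hPm v)
      rintro _ ⟨g, rfl⟩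
      have := orb_mem ρ (c • v) g
      rw [map_smul] at this
      exact this
    · intro g
      rw [map_smul, hPf]
  refine ⟨LinearMap.mkContinuous ⟨⟨P, hadd⟩, hsmul⟩ C
    fun v => orbHull_bound hC v _ (hPm v), fun v => ⟨hPm v, hPf v⟩⟩

end Gen


theorem alaoglu_birkhoff_decomposition
    {G : Type*} [Group G]
    {V : Type*} [NormedAddCommGroup V] [NormedSpace ℝ V] [CompleteSpace V]
    (ρ : G →* (V ≃L[ℝ] V))
    -- `ρ` is weakly almost periodic:
    (hwap : ∀ v : V, IsCompact (closure ((toWeakSpace ℝ V) '' (Set.range fun g => ρ g v)))) :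
    ∃ V₁ V₂ : Submodule ℝ V,
      -- closed subspaces:
      IsClosed (V₁ : Set V) ∧ IsClosed (V₂ : Set V) ∧
      -- `G`-invariant:
      (∀ g : G, ∀ v ∈ V₁, ρ g v ∈ V₁) ∧ (∀ g : G, ∀ v ∈ V₂, ρ g v ∈ V₂) ∧
      -- a direct sum decomposition `V = V₁ ⊕ V₂` ...
      IsCompl V₁ V₂ ∧
      -- ... which is topological: the projection onto `V₁` along `V₂` is bounded:
      (∃ p : V →L[ℝ] V, (∀ v ∈ V₁, p v = v) ∧ (∀ v ∈ V₂, p v = 0)) ∧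
      -- `V₁` is the set of `G`-invariant vectors:
      (V₁ : Set V) = {v | ∀ g : G, ρ g v = v} ∧
      -- `V₂` is the set of vectors whose orbit's closed convex hull contains `0`:
      (V₂ : Set V) = {v | (0 : V) ∈ closure (convexHull ℝ (Set.range fun g => ρ g v))} := by
  have hw : Wap ρ := hwap
  obtain ⟨p, hp⟩ := exists_proj hw
  have huniq : ∀ v w, w ∈ orbHull ρ v → (∀ g, ρ g w = w) → p v = w :=
    fun v w h1 h2 => fixed_unique hw v (hp v).1 (hp v).2 h1 h2
  have hfix : ∀ v, (∀ g, ρ g v = v) → p v = v := fun v hv => huniq v v (self_mem ρ v) hv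
  let V₁ : Submodule ℝ V :=
    { carrier := {v | ∀ g : G, ρ g v = v}
      add_mem' := fun {a b} ha hb g => by rw [map_add, ha g, hb g]
      zero_mem' := fun g => map_zero _
      smul_mem' := fun c a ha g => by rw [map_smul, ha g] }
  have hV₁ : ∀ v, v ∈ V₁ ↔ ∀ g, ρ g v = v := fun v => Iff.rfl
  have hV₂ : ∀ v, v ∈ LinearMap.ker p.toLinearMap ↔ p v = 0 := fun v => Iff.rfl
  refine ⟨V₁, LinearMap.ker p.toLinearMap, ?_, p.isClosed_ker, ?_, ?_, ?_, ⟨p, hfix, ?_⟩, rfl, ?_⟩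
  · have : (V₁ : Set V) = ⋂ g : G, {v | ρ g v = v} := by
      ext v; simp [hV₁]
    rw [this]
    exact isClosed_iInter fun g => isClosed_eq (ρ g).continuous continuous_id
  · intro g v hv
    rw [(hV₁ v).1 hv g]
    exact hv
  · intro g v hv
    rw [hV₂] at hv ⊢
    rw [← hv]
    exact (huniq v _ (orbHull_subset ρ (orb_mem ρ v g) (hp _).1) (hp _).2).symm
  · constructor
    · rw [Submodule.disjoint_def]
      intro v h1 h2
      rw [← hfix v h1]
      exact h2
    · rw [codisjoint_iff, Submodule.eq_top_iff']
      intro v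
      rw [Submodule.mem_sup]
      refine ⟨p v, (hp v).2, v - p v, ?_, add_sub_cancel _ _⟩
      rw [hV₂, map_sub, hfix (p v) (hp v).2, sub_self]
  · intro v hv
    exact hv
  · ext v
    constructor
    · intro hv
      have h := (hp v).1
      rw [(hV₂ v).1 hv] at h
      exact h
    · intro hv
      exact huniq v 0 hv fun g => map_zero _
end

section
/- (Ryll-Nardzewski fixed point theorem) Let G be a group acting by affine isometries on a nonempty weakly compact convex subset C of a Banach space V. Then there exists a point v ∈ C fixed by every element of G. -/
namespace RN

open Set TopologicalSpace

variable {V : Type*} [NormedAddCommGroup V] [NormedSpace ℝ V]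

/-- weakly closed -/
def WC (A : Set V) : Prop := IsClosed ((toWeakSpace ℝ V).symm ⁻¹' A)

/-- weakly compact -/
def WK (A : Set V) : Prop := IsCompact ((toWeakSpace ℝ V).symm ⁻¹' A)

theorem WC.closed {A : Set V} (h : WC A) : IsClosed A :=
  h.preimage (toWeakSpaceCLM ℝ V).continuous

theorem wc_of_convex {A : Set V} (hc : Convex ℝ A) (h : IsClosed A) : WC A := by
  have h1 := hc.toWeakSpace_closure ℝ
  rw [h.closure_eq] at h1
  have h2 : IsClosed (toWeakSpace ℝ V '' A) := by
    rw [h1]; exact isClosed_closure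
  rw [LinearEquiv.image_eq_preimage_symm] at h2
  exact h2

theorem WK.wc {A : Set V} (h : WK A) : WC A := IsCompact.isClosed h

theorem WK.of_wc {A B : Set V} (h : WK A) (hB : WC B) (hBA : B ⊆ A) : WK B :=
  IsCompact.of_isClosed_subset h hB (preimage_mono hBA)

theorem WC.inter {A B : Set V} (h : WC A) (hB : WC B) : WC (A ∩ B) := IsClosed.inter h hB

theorem wc_iInter {ι : Sort*} {A : ι → Set V} (h : ∀ i, WC (A i)) : WC (⋂ i, A i) := by
  unfold WC
  rw [preimage_iInter]
  exact isClosed_iInter h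

theorem wc_sInter {c : Set (Set V)} (h : ∀ i ∈ c, WC i) : WC (⋂₀ c) := by
  rw [sInter_eq_iInter]
  exact wc_iInter fun i => h i i.2

theorem WK.inter_iInter {ι : Type*} {K : Set V} (hK : WK K) (t : ι → Set V)
    (ht : ∀ i, WC (t i)) (h : ∀ u : Finset ι, (K ∩ ⋂ i ∈ u, t i).Nonempty) :
    (K ∩ ⋂ i, t i).Nonempty := by
  have := IsCompact.inter_iInter_nonempty hK (fun i => (toWeakSpace ℝ V).symm ⁻¹' (t i)) ht
    (fun u => by
      obtain ⟨x, hx⟩ := h u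
      refine ⟨toWeakSpace ℝ V x, ?_⟩
      simpa using hx)
  obtain ⟨x, hx⟩ := this
  refine ⟨(toWeakSpace ℝ V).symm x, ?_⟩
  simpa using hx

/-- minimal nonempty elements of a family of weakly closed sets stable by intersections -/
theorem exists_minimal (P : Set V → Prop) (hP : ∀ c : Set (Set V), c.Nonempty → (∀ s ∈ c, P s) → P (⋂₀ c))
    {A : Set V} (hA : WK A) (hAP : P A) (hne : A.Nonempty) :
    ∃ M ⊆ A, P M ∧ WC M ∧ M.Nonempty ∧ ∀ N ⊆ M, P N → WC N → N.Nonempty → N = M := by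
  obtain ⟨M, hMA, hM⟩ := zorn_superset_nonempty {s | s ⊆ A ∧ P s ∧ WC s ∧ s.Nonempty} (by
    intro c hc hch hcn
    refine ⟨⋂₀ c, ⟨?_, hP c hcn fun s hs => (hc hs).2.1, wc_sInter fun s hs => (hc hs).2.2.1, ?_⟩,
      fun s hs => sInter_subset_of_mem hs⟩
    · obtain ⟨s, hs⟩ := hcn
      exact (sInter_subset_of_mem hs).trans (hc hs).1
    · have := hcn.to_subtype
      have key := IsCompact.nonempty_iInter_of_directed_nonempty_isCompact_isClosed
        (fun s : c => (toWeakSpace ℝ V).symm ⁻¹' (s : Set V))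
        (by
          intro s t
          rcases hch.total s.2 t.2 with h | h
          · exact ⟨s, subset_rfl, preimage_mono h⟩
          · exact ⟨t, preimage_mono h, subset_rfl⟩)
        (fun s => by
          obtain ⟨x, hx⟩ := (hc s.2).2.2.2
          exact ⟨toWeakSpace ℝ V x, by simpa using hx⟩)
        (fun s => hA.of_wc (hc s.2).2.2.1 (hc s.2).1)
        (fun s => (hc s.2).2.2.1)
      obtain ⟨x, hx⟩ := key
      refine ⟨(toWeakSpace ℝ V).symm x, ?_⟩
      rw [mem_iInter] at hx
      exact fun s hs => hx ⟨s, hs⟩) A ⟨subset_rfl, hAP, hA.wc, hne⟩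
  refine ⟨M, hMA, hM.1.2.1, hM.1.2.2.1, hM.1.2.2.2, fun N hN h1 h2 h3 => ?_⟩
  exact subset_antisymm hN (hM.2 ⟨hN.trans hMA, h1, h2, h3⟩ hN)

/-- affine on a set -/
def Aff (C : Set V) (T : V → V) : Prop := ∀ x ∈ C, ∀ y ∈ C, ∀ t ∈ Set.Icc (0 : ℝ) 1,
      T (t • x + (1 - t) • y) = t • T x + (1 - t) • T y

/-- isometric on a set -/
def Iso (C : Set V) (T : V → V) : Prop := ∀ x ∈ C, ∀ y ∈ C, ‖T x - T y‖ = ‖x - y‖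

theorem Iso.cont {C : Set V} {T : V → V} (h : Iso C T) : ContinuousOn T C := by
  have : LipschitzOnWith 1 T C := by
    refine LipschitzOnWith.of_dist_le_mul fun x hx y hy => ?_
    rw [dist_eq_norm, dist_eq_norm, h x hx y hy]; simp
  exact this.continuousOn

theorem Aff.preimage_convex {C B : Set V} {T : V → V} (hC : Convex ℝ C) (h : Aff C T)
    (hB : Convex ℝ B) : Convex ℝ (C ∩ T ⁻¹' B) := by
  intro x hx y hy a b ha hb hab
  refine ⟨hC hx.1 hy.1 ha hb hab, ?_⟩
  obtain rfl : b = 1 - a := by linarith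
  rw [mem_preimage, h x hx.1 y hy.1 a ⟨ha, by linarith⟩]
  exact hB hx.2 hy.2 ha hb hab

theorem preimage_wc_of_convex {C B : Set V} {T : V → V} (hC : Convex ℝ C) (hCc : IsClosed C)
    (h : Aff C T) (hi : Iso C T) (hB : Convex ℝ B) (hBc : IsClosed B) : WC (C ∩ T ⁻¹' B) :=
  wc_of_convex (h.preimage_convex hC hB) (hi.cont.preimage_isClosed_of_isClosed hCc hBc)

theorem preimage_wc {C B : Set V} {T : V → V} (hC : Convex ℝ C) (hCc : IsClosed C)
    (h : Aff C T) (hi : Iso C T) (hB : WC B) : WC (C ∩ T ⁻¹' B) := by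
  have hCw : WC C := wc_of_convex hC hCc
  have hc : ContinuousOn (fun x : WeakSpace ℝ V => toWeakSpace ℝ V (T ((toWeakSpace ℝ V).symm x)))
      ((toWeakSpace ℝ V).symm ⁻¹' C) := by
    rw [continuousOn_iff_continuous_domRestrict]
    refine WeakBilin.continuous_of_continuous_eval _ fun f => ?_
    have hf : ∀ a : ℝ, WC (C ∩ T ⁻¹' {y | f y ≤ a}) ∧ WC (C ∩ T ⁻¹' {y | a ≤ f y}) := fun a =>
      ⟨preimage_wc_of_convex hC hCc h hi
        (convex_halfSpace_le (f := f) ⟨map_add f, map_smul f⟩ a)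
        (isClosed_le f.continuous continuous_const),
      preimage_wc_of_convex hC hCc h hi
        (convex_halfSpace_ge (f := f) ⟨map_add f, map_smul f⟩ a)
        (isClosed_le continuous_const f.continuous)⟩
    change Continuous (fun x : ((toWeakSpace ℝ V).symm ⁻¹' C : Set (WeakSpace ℝ V)) =>
      f (T ((toWeakSpace ℝ V).symm x)))
    refine continuous_iff_lower_upperSemicontinuous.2 ⟨?_, ?_⟩
    · rw [lowerSemicontinuous_iff_isClosed_preimage]
      intro a
      have := IsClosed.preimage (continuous_subtype_val (p := (· ∈ ((toWeakSpace ℝ V).symm ⁻¹' C)))) (hf a).1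
      convert this using 1
      ext x
      exact ⟨fun hx => ⟨x.2, hx⟩, fun hx => hx.2⟩
    · rw [upperSemicontinuous_iff_isClosed_preimage]
      intro a
      have := IsClosed.preimage (continuous_subtype_val (p := (· ∈ ((toWeakSpace ℝ V).symm ⁻¹' C)))) (hf a).2
      convert this using 1
      ext x
      exact ⟨fun hx => ⟨x.2, hx⟩, fun hx => hx.2⟩
  exact hc.preimage_isClosed_of_isClosed hCw hB

/-- action by affine isometries on `C` -/
structure Act {G : Type*} [Group G] (C : Set V) (α : G → V → V) : Prop where
  maps : ∀ g : G, Set.MapsTo (α g) C C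
  one : ∀ x ∈ C, α 1 x = x
  mul : ∀ g h : G, ∀ x ∈ C, α (g * h) x = α g (α h x)
  aff : ∀ g : G, Aff C (α g)
  iso : ∀ g : G, Iso C (α g)

section
variable {G : Type*} [Group G] {C K X : Set V} {α : G → V → V}

theorem Act.mono (h : Act C α) (hK : K ⊆ C) (hm : ∀ g, MapsTo (α g) K K) : Act K α where
  maps := hm
  one x hx := h.one x (hK hx)
  mul g k x hx := h.mul g k x (hK hx)
  aff g x hx y hy := h.aff g x (hK hx) y (hK hy)
  iso g x hx y hy := h.iso g x (hK hx) y (hK hy)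

theorem Act.inv_cancel (h : Act C α) (g : G) {x : V} (hx : x ∈ C) : α g (α g⁻¹ x) = x := by
  rw [← h.mul _ _ _ hx, mul_inv_cancel, h.one _ hx]

theorem Act.hull (h : Act K α) (hc : Convex ℝ K) (hcl : IsClosed K) (hX : X ⊆ K)
    (hm : ∀ g, MapsTo (α g) X X) (g : G) :
    MapsTo (α g) (closedConvexHull ℝ X) (closedConvexHull ℝ X) := by
  have : closedConvexHull ℝ X ⊆ K ∩ α g ⁻¹' (closedConvexHull ℝ X) :=
    closedConvexHull_min (fun x hx => ⟨hX hx, subset_closedConvexHull (hm g hx)⟩)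
      ((h.aff g).preimage_convex hc convex_closedConvexHull)
      ((h.iso g).cont.preimage_isClosed_of_isClosed hcl isClosed_closedConvexHull)
  exact fun x hx => (this hx).2

theorem separable_hull (hX : X.Countable) : IsSeparable (closedConvexHull ℝ X : Set V) := by
  refine IsSeparable.mono (hX.isSeparable.span (R := ℝ)).closure ?_
  refine closedConvexHull_min (Submodule.subset_span.trans subset_closure) ?_ isClosed_closure
  exact (Submodule.convex _).closure

theorem exists_small_open (hX : WK X) (hne : X.Nonempty) (hs : IsSeparable X) {ε : ℝ}
    (hε : 0 < ε) : ∃ F : Set V, WC F ∧ ∃ c : V, (∃ p ∈ X, p ∉ F) ∧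
      ∀ x ∈ X, x ∉ F → ‖x - c‖ ≤ ε := by
  obtain ⟨D, hD, hXD⟩ := hs
  set Y : Set (WeakSpace ℝ V) := (toWeakSpace ℝ V).symm ⁻¹' X with hY
  have : CompactSpace Y := isCompact_iff_compactSpace.1 hX
  have : Nonempty Y := by
    obtain ⟨x, hx⟩ := hne
    exact ⟨⟨toWeakSpace ℝ V x, by simpa [hY] using hx⟩⟩
  have := hD.to_subtype
  obtain ⟨d, hd⟩ := nonempty_interior_of_iUnion_of_closed
    (f := fun d : D => ((↑) : Y → WeakSpace ℝ V) ⁻¹'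
      ((toWeakSpace ℝ V).symm ⁻¹' (Metric.closedBall (d : V) ε)))
    (fun d => IsClosed.preimage continuous_subtype_val
      (wc_of_convex (convex_closedBall _ _) Metric.isClosed_closedBall))
    (by
      rw [eq_univ_iff_forall]
      intro y
      obtain ⟨b, hb, hb2⟩ := Metric.mem_closure_iff.1 (hXD y.2) ε hε
      exact mem_iUnion.2 ⟨⟨b, hb⟩, hb2.le⟩)
  obtain ⟨U, hU, hUe⟩ := isOpen_induced_iff.1 (isOpen_interior (s := ((↑) : Y → WeakSpace ℝ V) ⁻¹'
      ((toWeakSpace ℝ V).symm ⁻¹' (Metric.closedBall (d : V) ε))))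
  refine ⟨toWeakSpace ℝ V ⁻¹' Uᶜ, ?_, d, ?_, ?_⟩
  · exact hU.isClosed_compl
  · obtain ⟨y, hy⟩ := hd
    refine ⟨(toWeakSpace ℝ V).symm y, y.2, ?_⟩
    rw [← hUe] at hy
    simpa using hy
  · intro x hx hxU
    have h1 : (⟨toWeakSpace ℝ V x, hx⟩ : Y) ∈ ((↑) : Y → WeakSpace ℝ V) ⁻¹' U := by
      simpa using hxU
    rw [hUe] at h1
    have h2 := interior_subset h1
    have h3 : x ∈ Metric.closedBall (d : V) ε := h2
    rwa [mem_closedBall_iff_norm] at h3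

theorem exists_net (h : Act K α) (hc : Convex ℝ K) (hcl : IsClosed K) (hXK : X ⊆ K) (hX : WK X)
    (hne : X.Nonempty) (hs : IsSeparable X) (hm : ∀ g, MapsTo (α g) X X)
    (hmin : ∀ N ⊆ X, (∀ g, MapsTo (α g) N N) → WC N → N.Nonempty → N = X)
    {ε : ℝ} (hε : 0 < ε) :
    ∃ F : Finset V, (F : Set V) ⊆ X ∧ ∀ x ∈ X, ∃ y ∈ F, ‖x - y‖ ≤ ε := by
  classical
  obtain ⟨F, hF, c, ⟨p, hpX, hpF⟩, hball⟩ := exists_small_open hX hne hs (half_pos hε)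
  have hpre : ∀ g, WC (K ∩ α g ⁻¹' F) := fun g => preimage_wc hc hcl (h.aff g) (h.iso g) hF
  have hempty : ¬ (X ∩ ⋂ g, (K ∩ α g ⁻¹' F)).Nonempty := by
    intro hn
    have := hmin (X ∩ ⋂ g, (K ∩ α g ⁻¹' F)) inter_subset_left (by
      intro g x hx
      refine ⟨hm g hx.1, mem_iInter.2 fun k => ⟨hXK (hm g hx.1), ?_⟩⟩
      have := (mem_iInter.1 hx.2 (k * g)).2
      rw [mem_preimage, h.mul _ _ _ (hXK hx.1)] at this
      exact this) (hX.wc.inter (wc_iInter hpre)) hn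
    rw [← this] at hpX
    have := (mem_iInter.1 hpX.2 1).2
    rw [mem_preimage, h.one _ (mem_iInter.1 hpX.2 1).1] at this
    exact hpF this
  have hfin : ∃ u : Finset G, ¬ (X ∩ ⋂ g ∈ u, (K ∩ α g ⁻¹' F)).Nonempty := by
    by_contra! hcon
    exact hempty (hX.inter_iInter _ hpre hcon)
  obtain ⟨u, hu⟩ := hfin
  refine ⟨u.image fun g => α g⁻¹ p, ?_, ?_⟩
  · intro x hx
    simp only [Finset.coe_image, mem_image] at hx
    obtain ⟨g, -, rfl⟩ := hx
    exact hm _ hpX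
  · intro x hx
    have : ∃ g ∈ u, α g x ∉ F := by
      by_contra! hcon
      exact hu ⟨x, hx, mem_iInter₂.2 fun g hg => ⟨hXK hx, hcon g hg⟩⟩
    obtain ⟨g, hg, hgF⟩ := this
    refine ⟨α g⁻¹ p, Finset.mem_image_of_mem _ hg, ?_⟩
    rw [← h.iso g x (hXK hx) _ (hXK (hm _ hpX)), h.inv_cancel g (hXK hpX)]
    have h1 := hball _ (hm g hx) hgF
    have h2 := hball _ hpX hpF
    calc ‖α g x - p‖ = ‖(α g x - c) - (p - c)‖ := by congr 1; abel
      _ ≤ ‖α g x - c‖ + ‖p - c‖ := norm_sub_le _ _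
      _ ≤ ε := by linarith

theorem center (h : Act K α) (hc : Convex ℝ K) (hcl : IsClosed K) (hX : X ⊆ K)
    (hXK : closedConvexHull ℝ X = K)
    (hmin : ∀ N ⊆ K, Convex ℝ N → (∀ g, MapsTo (α g) N N) → WC N → N.Nonempty → N = K)
    (hnet : ∀ ε > 0, ∃ F : Finset V, (F : Set V) ⊆ X ∧ ∀ x ∈ X, ∃ y ∈ F, ‖x - y‖ ≤ ε) :
    K.Subsingleton := by
  classical
  intro a ha b hb
  by_contra hab
  have hpos : 0 < ‖a - b‖ := norm_pos_iff.2 (sub_ne_zero.2 hab)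
  set ε := ‖a - b‖ / 2 with hεd
  have hε : 0 < ε := half_pos hpos
  obtain ⟨F, hFX, hF⟩ := hnet ε hε
  have hXne : X.Nonempty := by
    by_contra hcon
    rw [not_nonempty_iff_eq_empty] at hcon
    have : K ⊆ ∅ := by
      rw [← hXK]
      exact closedConvexHull_min hcon.subset convex_empty isClosed_empty
    exact this ha
  have hFne : F.Nonempty := by
    obtain ⟨x, hx⟩ := hXne
    obtain ⟨y, hy, -⟩ := hF x hx
    exact ⟨y, hy⟩
  have hbd : Bornology.IsBounded K := by
    have h1 : Bornology.IsBounded (⋃ y ∈ F, Metric.closedBall y ε) :=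
      (Bornology.isBounded_biUnion_finset F).2 fun y _ => Metric.isBounded_closedBall
    obtain ⟨r, hr⟩ := h1.subset_closedBall 0
    refine (Metric.isBounded_closedBall (x := (0 : V)) (r := r)).subset ?_
    rw [← hXK]
    refine closedConvexHull_min (fun x hx => hr ?_) (convex_closedBall _ _)
      Metric.isClosed_closedBall
    obtain ⟨y, hy, hxy⟩ := hF x hx
    exact mem_iUnion₂.2 ⟨y, hy, mem_closedBall_iff_norm.2 hxy⟩
  set d := Metric.diam K with hd
  have hdist : ∀ x ∈ K, ∀ y ∈ K, ‖x - y‖ ≤ d := fun x hx y hy => by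
    rw [← dist_eq_norm]; exact Metric.dist_le_diam_of_mem hbd hx hy
  have hεle : 2 * ε ≤ d := by
    have := hdist a ha b hb
    rw [hεd]; linarith
  have hn : (0 : ℝ) < F.card := by exact_mod_cast hFne.card_pos
  set n : ℝ := (F.card : ℝ) with hnd
  set u : V := ∑ y ∈ F, n⁻¹ • y with hu
  set r : ℝ := d - ε / n with hr
  have hsum1 : ∑ y ∈ F, n⁻¹ = 1 := by
    rw [Finset.sum_const, nsmul_eq_mul, ← hnd, mul_inv_cancel₀ hn.ne']
  have huK : u ∈ K := hc.sum_mem (fun _ _ => (inv_pos.2 hn).le) hsum1 fun y hy => hX (hFX hy)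
  have hux : ∀ x ∈ X, ‖x - u‖ ≤ r := by
    intro x hx
    obtain ⟨z, hz, hxz⟩ := hF x hx
    have e1 : x - u = ∑ y ∈ F, n⁻¹ • (x - y) := by
      simp_rw [smul_sub]
      rw [Finset.sum_sub_distrib, ← Finset.sum_smul, hsum1, one_smul]
    rw [e1]
    calc ‖∑ y ∈ F, n⁻¹ • (x - y)‖ ≤ ∑ y ∈ F, ‖n⁻¹ • (x - y)‖ := norm_sum_le _ _
      _ = n⁻¹ * ∑ y ∈ F, ‖x - y‖ := by
        rw [Finset.mul_sum]
        refine Finset.sum_congr rfl fun y _ => ?_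
        rw [norm_smul, Real.norm_of_nonneg (inv_pos.2 hn).le]
      _ ≤ n⁻¹ * (n * d - ε) := by
        refine mul_le_mul_of_nonneg_left ?_ (inv_pos.2 hn).le
        calc ∑ y ∈ F, ‖x - y‖ ≤ ∑ y ∈ F, (d - if y = z then ε else 0) := by
              refine Finset.sum_le_sum fun y hy => ?_
              split_ifs with hyz
              · subst hyz; linarith
              · rw [sub_zero]; exact hdist x (hX hx) y (hX (hFX hy))
          _ = n * d - ε := by
              rw [Finset.sum_sub_distrib, Finset.sum_const, nsmul_eq_mul, Finset.sum_ite_eq',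
                if_pos hz]
      _ = r := by rw [hr]; field_simp
  have huK2 : ∀ x ∈ K, ‖x - u‖ ≤ r := by
    have : K ⊆ Metric.closedBall u r := by
      rw [← hXK]
      exact closedConvexHull_min (fun x hx => mem_closedBall_iff_norm.2 (hux x hx))
        (convex_closedBall _ _) Metric.isClosed_closedBall
    exact fun x hx => mem_closedBall_iff_norm.1 (this hx)
  have hNc : Convex ℝ (K ∩ ⋂ y ∈ K, Metric.closedBall y r) :=
    hc.inter (convex_iInter₂ fun y _ => convex_closedBall y r)
  have hN := hmin (K ∩ ⋂ y ∈ K, Metric.closedBall y r) inter_subset_left hNc (by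
      intro g x hx
      refine ⟨h.maps g hx.1, mem_iInter₂.2 fun y hy => mem_closedBall_iff_norm.2 ?_⟩
      rw [← h.inv_cancel g hy, h.iso g x hx.1 _ (h.maps _ hy)]
      exact mem_closedBall_iff_norm.1 (mem_iInter₂.1 hx.2 _ (h.maps _ hy)))
    (wc_of_convex hNc (hcl.inter (isClosed_biInter fun y _ => Metric.isClosed_closedBall)))
    ⟨u, huK, mem_iInter₂.2 fun y hy => by
      rw [mem_closedBall_iff_norm, norm_sub_rev]; exact huK2 y hy⟩
  have hεn : 0 < ε / n := div_pos hε hn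
  have hr0 : 0 ≤ r := (norm_nonneg _).trans (huK2 u huK)
  have : d ≤ r := by
    refine Metric.diam_le_of_forall_dist_le hr0 fun x hx y hy => ?_
    rw [← hN] at hx
    exact mem_iInter₂.1 hx.2 y hy
  linarith

theorem countable_case [Countable G] (h : Act C α) (hc : Convex ℝ C) (hC : WK C)
    (hne : C.Nonempty) : ∃ v ∈ C, ∀ g, α g v = v := by
  obtain ⟨K, hKC, ⟨hKc, hKm⟩, hKw, hKne, hKmin⟩ := exists_minimal
    (fun A : Set V => Convex ℝ A ∧ ∀ g, MapsTo (α g) A A)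
    (fun c _ hcs => ⟨convex_sInter fun s hs => (hcs s hs).1,
      fun g x hx s hs => (hcs s hs).2 g (hx s hs)⟩) hC ⟨hc, h.maps⟩ hne
  have hK : Act K α := h.mono hKC hKm
  have hKk : WK K := hC.of_wc hKw hKC
  have hhull : ∀ Y ⊆ K, Y.Nonempty → (∀ g, MapsTo (α g) Y Y) → closedConvexHull ℝ Y = K :=
    fun Y hY hYne hYm => hKmin _ (closedConvexHull_min hY hKc hKw.closed)
      ⟨convex_closedConvexHull, hK.hull hKc hKw.closed hY hYm⟩
      (wc_of_convex convex_closedConvexHull isClosed_closedConvexHull)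
      (hYne.mono subset_closedConvexHull)
  have hsep : IsSeparable K := by
    obtain ⟨x, hx⟩ := hKne
    rw [← hhull (range fun g => α g x) (by rintro _ ⟨g, rfl⟩; exact hKm g hx)
      ⟨_, mem_range_self 1⟩ (by
        rintro g _ ⟨k, rfl⟩
        exact ⟨g * k, hK.mul _ _ _ hx⟩)]
    exact separable_hull (countable_range _)
  obtain ⟨X, hXK, hXm, hXw, hXne, hXmin⟩ := exists_minimal
    (fun A : Set V => ∀ g, MapsTo (α g) A A)
    (fun c _ hcs => fun g x hx s hs => (hcs s hs) g (hx s hs)) hKk hKm hKne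
  have hsub := center hK hKc hKw.closed hXK (hhull X hXK hXne hXm)
    (fun N h1 h2 h3 => hKmin N h1 ⟨h2, h3⟩)
    (fun ε hε => exists_net hK hKc hKw.closed hXK (hKk.of_wc hXw hXK) hXne (hsep.mono hXK) hXm
      hXmin hε)
  obtain ⟨v, hv⟩ := hKne
  exact ⟨v, hKC hv, fun g => hsub (hKm g hv) hv⟩

theorem general_case (h : Act C α) (hc : Convex ℝ C) (hC : WK C)
    (hne : C.Nonempty) : ∃ v ∈ C, ∀ g, α g v = v := by
  have hfix : ∀ g, WC (C ∩ {x | α g x = x}) := by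
    intro g
    refine wc_of_convex ?_ ?_
    · intro x hx y hy a b ha hb hab
      refine ⟨hc hx.1 hy.1 ha hb hab, ?_⟩
      obtain rfl : b = 1 - a := by linarith
      rw [mem_ofPred_eq, h.aff g x hx.1 y hy.1 a ⟨ha, by linarith⟩, hx.2, hy.2]
    · have := ((h.iso g).cont.sub continuousOn_id).preimage_isClosed_of_isClosed hC.wc.closed
        (isClosed_singleton (x := (0 : V)))
      convert this using 1
      ext x
      simp [sub_eq_zero]
  obtain ⟨v, hv, hv2⟩ := hC.inter_iInter _ hfix (by
    intro u
    have : Countable (Subgroup.closure (u : Set G)) := by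
      have hq : Countable (FreeGroup ((u : Set G) : Type _)) :=
        Function.Surjective.countable (f := Quot.mk _) Quot.mk_surjective
      rw [FreeGroup.closure_eq_range]
      exact (MonoidHom.rangeRestrict_surjective _).countable
    obtain ⟨v, hv, hvf⟩ := countable_case (G := Subgroup.closure (u : Set G))
      (α := fun g => α (g : G)) (C := C)
      ⟨fun g => h.maps g, h.one, fun g k => h.mul g k, fun g => h.aff g, fun g => h.iso g⟩
      hc hC hne
    exact ⟨v, hv, mem_iInter₂.2 fun g hg => ⟨hv, hvf ⟨g, Subgroup.subset_closure hg⟩⟩⟩)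
  exact ⟨v, hv, fun g => (mem_iInter.1 hv2 g).2⟩

end

end RN


theorem ryll_nardzewski_fixed_point
    {G : Type*} [Group G]
    {V : Type*} [NormedAddCommGroup V] [NormedSpace ℝ V] [CompleteSpace V]
    (C : Set V) (hne : C.Nonempty) (hconv : Convex ℝ C)
    -- `C` is weakly compact:
    (hcomp : IsCompact ((toWeakSpace ℝ V) '' C))
    -- an action of `G` on `C`:
    (α : G → V → V)
    (hmaps : ∀ g : G, Set.MapsTo (α g) C C)
    (hone : ∀ x ∈ C, α 1 x = x)
    (hmul : ∀ g h : G, ∀ x ∈ C, α (g * h) x = α g (α h x))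
    -- each `α g` is affine on `C`:
    (haff : ∀ g : G, ∀ x ∈ C, ∀ y ∈ C, ∀ t ∈ Set.Icc (0 : ℝ) 1,
      α g (t • x + (1 - t) • y) = t • α g x + (1 - t) • α g y)
    -- and isometric on `C`:
    (hiso : ∀ g : G, ∀ x ∈ C, ∀ y ∈ C, ‖α g x - α g y‖ = ‖x - y‖) :
    ∃ v ∈ C, ∀ g : G, α g v = v := by

  refine RN.general_case (C := C) (α := α) ⟨hmaps, hone, hmul, haff, hiso⟩ hconv ?_ hne
  rw [LinearEquiv.image_eq_preimage_symm] at hcomp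
  exact hcomp
end
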